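/- arXiv:math/0306276 — 2 statements merged into one kernel-verified Lean document; each statement's English description precedes it below -/
import Mathlib

section
/- (Density of periodic points.) Let p : ℤ → ℝ² be a bi-infinite f-orbit with p(n) ∈ R₀ ∪ R₁ for all n ∈ ℤ. Then for every ε > 0 there exist a point q ∈ ℝ² and an integer m ≥ 1 such that the forward orbit of q is defined up to time m, f^m(q) = q, and the Euclidean distance ‖q − p(0)‖ is less than ε. That is, periodic points of f are dense in the set of points lying on bi-infinite real orbits in R₀ ∪ R₁. -/
open Filter

/-- The birational map f(x,y) = (y(x+a)/(x-1), x+a-1). -/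
noncomputable def birat (a : ℝ) (p : ℝ × ℝ) : ℝ × ℝ :=
  (p.2 * (p.1 + a) / (p.1 - 1), p.1 + a - 1)

/-- The inverse map f⁻¹(x,y) = (y+1-a, x(y-a)/(y+1)). -/
noncomputable def biratInv (a : ℝ) (p : ℝ × ℝ) : ℝ × ℝ :=
  (p.2 + 1 - a, p.1 * (p.2 - a) / (p.2 + 1))

/-- The forward orbit of `p` is defined up to time `n`. -/
def orbitDefined (a : ℝ) (p : ℝ × ℝ) (n : ℕ) : Prop :=
  ∀ k < n, ((birat a)^[k] p).1 ≠ 1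

def Rplus : Set (ℝ × ℝ) := {p | p.1 ≤ 1 ∧ p.2 ≤ 0}
def Rminus : Set (ℝ × ℝ) := {p | 0 ≤ p.1 ∧ -1 ≤ p.2}
def Rzero : Set (ℝ × ℝ) := {p | 1 ≤ p.1 ∧ p.2 ≤ -1}
def Rone : Set (ℝ × ℝ) := {p | p.1 ≤ 0 ∧ 0 ≤ p.2}
def intRplus : Set (ℝ × ℝ) := {p | p.1 < 1 ∧ p.2 < 0}
def intRzero : Set (ℝ × ℝ) := {p | 1 < p.1 ∧ p.2 < -1}
def intRone : Set (ℝ × ℝ) := {p | p.1 < 0 ∧ 0 < p.2}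

/-- `Rw 0 = R₀`, `Rw 1 = R₁`. -/
def Rw (i : Fin 2) : Set (ℝ × ℝ) := if i = 0 then Rzero else Rone

/-- `intRw 0 = int R₀`, `intRw 1 = int R₁`. -/
def intRw (i : Fin 2) : Set (ℝ × ℝ) := if i = 0 then intRzero else intRone

/-- Euclidean distance on ℝ². -/
noncomputable def eucDist (p q : ℝ × ℝ) : ℝ :=
  Real.sqrt ((p.1 - q.1) ^ 2 + (p.2 - q.2) ^ 2)

/-- Scattering form of `birat`: the outgoing quantity across a transition from state `i` to state
`j` (`false` for `R₀`, `true` for `R₁`) in terms of the two incoming ones. -/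
noncomputable def scatter (b : ℝ) : Bool → Bool → ℝ → ℝ → ℝ
  | false, false, s, t => 1 + (b - 1) * t / (s + t)
  | false, true, s, t => s * (t + 1) / (t + b)
  | true, false, s, _ => s + b + 1
  | true, true, _, _ => 1

noncomputable def logDist (x y : ℝ) : ℝ := |Real.log x - Real.log y|

theorem logDist_nonneg (x y : ℝ) : 0 ≤ logDist x y := abs_nonneg _

theorem logDist_comm (x y : ℝ) : logDist x y = logDist y x := abs_sub_comm _ _

theorem eq_of_logDist_eq_zero {x y : ℝ} (hx : 0 < x) (hy : 0 < y) (h : logDist x y = 0) :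
    x = y :=
  Real.log_injOn_pos hx hy (sub_eq_zero.mp (abs_eq_zero.mp h))

theorem scatter_pos {b : ℝ} (hb : 1 < b) {i j : Bool} {s t : ℝ} (hs : 0 < s) (ht : 0 < t) :
    0 < scatter b i j s t := by
  have := sub_pos.mpr hb
  cases i <;> cases j <;> simp only [scatter] <;> positivity

theorem log_ratio_contract {b : ℝ} (hb : 1 < b) {x y : ℝ} (hx : 0 < x) (hxy : x ≤ y) :
    Real.log (b * y + 1) - Real.log (y + b) - (Real.log (b * x + 1) - Real.log (x + b))
      ≤ (b - 1) / (b + 1) * (Real.log y - Real.log x) := by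
  have hd : ∀ z : ℝ, 0 < z → HasDerivAt
      (fun z => (b - 1) / (b + 1) * Real.log z - (Real.log (b * z + 1) - Real.log (z + b)))
      ((b - 1) / (b + 1) * z⁻¹ - (b / (b * z + 1) - 1 / (z + b))) z := by
    intro z hz
    have h1 : HasDerivAt (fun z : ℝ => b * z + 1) b z := by
      simpa using ((hasDerivAt_id z).const_mul b).add_const 1
    have h2 : HasDerivAt (fun z : ℝ => z + b) 1 z := (hasDerivAt_id z).add_const b
    exact ((Real.hasDerivAt_log hz.ne').const_mul _).sub
      ((h1.log (by positivity)).sub (h2.log (by positivity)))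
  have hm : MonotoneOn (fun z => (b - 1) / (b + 1) * Real.log z -
      (Real.log (b * z + 1) - Real.log (z + b))) (Set.Ioi 0) := by
    refine monotoneOn_of_deriv_nonneg (convex_Ioi 0)
      (fun z hz => (hd z hz).continuousAt.continuousWithinAt) ?_ ?_
    · rw [interior_Ioi]
      exact fun z hz => (hd z hz).differentiableAt.differentiableWithinAt
    · rw [interior_Ioi]
      intro z hz
      have hz : 0 < z := hz
      rw [(hd z hz).deriv]
      have : (b - 1) / (b + 1) * z⁻¹ - (b / (b * z + 1) - 1 / (z + b))
          = (b - 1) * b * (z - 1) ^ 2 / ((b + 1) * z * (b * z + 1) * (z + b)) := by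
        field_simp
        ring
      rw [this]
      have := sub_pos.mpr hb
      positivity
  have := hm (Set.mem_Ioi.mpr hx) (Set.mem_Ioi.mpr (hx.trans_le hxy)) hxy
  simp only at this
  linarith

theorem scatter_zero_zero_eq {b s t : ℝ} (hs : 0 < s) (ht : 0 < t) :
    scatter b false false s t = (b * (t / s) + 1) / (t / s + 1) := by
  simp only [scatter]
  field_simp
  ring

theorem scatter_zero_zero_eq' {b s t : ℝ} (hs : 0 < s) (ht : 0 < t) :
    scatter b false false t s = (t / s + b) / (t / s + 1) := by
  simp only [scatter]
  field_simp
  ring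

theorem step_zero_zero {b : ℝ} (hb : 1 < b) {s t s' t' : ℝ} (hs : 0 < s) (ht : 0 < t)
    (hs' : 0 < s') (ht' : 0 < t') :
    logDist (scatter b false false t s) (scatter b false false t' s') +
      logDist (scatter b false false s t) (scatter b false false s' t')
      ≤ (b - 1) / (b + 1) * (logDist s s' + logDist t t') := by
  wlog h : t / s ≤ t' / s' generalizing s t s' t'
  · have := this hs' ht' hs ht (le_of_not_ge h)
    simpa only [logDist_comm] using this
  have hx : 0 < t / s := by positivity
  have hy : 0 < t' / s' := by positivity
  have key := log_ratio_contract hb hx h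
  rw [scatter_zero_zero_eq hs ht, scatter_zero_zero_eq' hs ht, scatter_zero_zero_eq hs' ht',
    scatter_zero_zero_eq' hs' ht']
  have hlog : Real.log (t' / s') - Real.log (t / s) ≤ logDist s s' + logDist t t' := by
    rw [Real.log_div ht'.ne' hs'.ne', Real.log_div ht.ne' hs.ne']
    unfold logDist
    have h1 := le_abs_self (Real.log s - Real.log s')
    have h2 := neg_abs_le (Real.log t - Real.log t')
    linarith
  generalize t / s = x at *
  generalize t' / s' = y at *
  have e1 : (b * x + 1) / (x + 1) ≤ (b * y + 1) / (y + 1) := by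
    rw [div_le_div_iff₀ (by positivity) (by positivity)]
    nlinarith
  have e2 : (y + b) / (y + 1) ≤ (x + b) / (x + 1) := by
    rw [div_le_div_iff₀ (by positivity) (by positivity)]
    nlinarith
  have l1 := Real.log_le_log (by positivity) e1
  have l2 := Real.log_le_log (by positivity) e2
  have hk : 0 ≤ (b - 1) / (b + 1) := div_nonneg (by linarith) (by linarith)
  refine le_trans ?_ (key.trans (mul_le_mul_of_nonneg_left hlog hk))
  unfold logDist
  rw [abs_of_nonneg (by linarith), abs_of_nonpos (by linarith)]
  rw [Real.log_div (by positivity) (by positivity), Real.log_div (by positivity) (by positivity),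
    Real.log_div (by positivity) (by positivity), Real.log_div (by positivity) (by positivity)]
  linarith

theorem step_zero_one_aux {b : ℝ} (hb : 1 < b) {s t s' t' : ℝ} (hs : 0 < s) (ht : 0 < t)
    (hs' : 0 < s') (htt : t < t') :
    logDist (scatter b true false t s) (scatter b true false t' s') +
      logDist (scatter b false true s t) (scatter b false true s' t')
      < logDist s s' + logDist t t' := by
  have ht' := ht.trans htt
  simp only [scatter]
  have e1 : (t + 1) / (t + b) ≤ (t' + 1) / (t' + b) := by
    rw [div_le_div_iff₀ (by positivity) (by positivity)]
    nlinarith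
  have e2 : (t' + b + 1) * ((t' + 1) / (t' + b)) * t < (t + b + 1) * ((t + 1) / (t + b)) * t' := by
    rw [mul_div_assoc', mul_div_assoc', div_mul_eq_mul_div, div_mul_eq_mul_div,
      div_lt_div_iff₀ (by positivity) (by positivity)]
    have h0 : 0 < t' - t := by linarith
    have : (t + b + 1) * (t + 1) * t' * (t' + b) - (t' + b + 1) * (t' + 1) * t * (t + b)
        = (t' - t) * (2 * t * t' + (b + 1) * (t + t') + b * (b + 1)) := by ring
    have : 0 < (t' - t) * (2 * t * t' + (b + 1) * (t + t') + b * (b + 1)) := by positivity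
    linarith
  have l0 := Real.log_le_log (by positivity) htt.le
  have l1 := Real.log_le_log (by positivity) e1
  have l2 := Real.log_lt_log (by positivity) e2
  have l3 : Real.log (t + b + 1) ≤ Real.log (t' + b + 1) :=
    Real.log_le_log (by positivity) (by linarith)
  rw [Real.log_mul (by positivity) (by positivity), Real.log_mul (by positivity) (by positivity),
    Real.log_mul (by positivity) (by positivity), Real.log_mul (by positivity) (by positivity)]
    at l2
  unfold logDist
  rw [mul_div_assoc, mul_div_assoc, Real.log_mul (by positivity) (by positivity),
    Real.log_mul (by positivity) (by positivity), abs_of_nonpos (a := Real.log t - Real.log t')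
    (by linarith), abs_of_nonpos (a := Real.log (t + b + 1) - Real.log (t' + b + 1)) (by linarith)]
  have h1 := le_abs_self (Real.log s - Real.log s')
  have h2 := neg_abs_le (Real.log s - Real.log s')
  have : |Real.log s + Real.log ((t + 1) / (t + b)) -
      (Real.log s' + Real.log ((t' + 1) / (t' + b)))| ≤
      |Real.log s - Real.log s'| +
        (Real.log ((t' + 1) / (t' + b)) - Real.log ((t + 1) / (t + b))) := by
    rw [abs_le]
    constructor <;> linarith
  linarith

theorem step_zero_one {b : ℝ} (hb : 1 < b) {s t s' t' : ℝ} (hs : 0 < s) (ht : 0 < t)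
    (hs' : 0 < s') (ht' : 0 < t') (hne : t ≠ t') :
    logDist (scatter b true false t s) (scatter b true false t' s') +
      logDist (scatter b false true s t) (scatter b false true s' t')
      < logDist s s' + logDist t t' := by
  rcases lt_or_gt_of_ne hne with h | h
  · exact step_zero_one_aux hb hs ht hs' h
  · have := step_zero_one_aux hb hs' ht' hs h
    simpa only [logDist_comm] using this

theorem step_zero_one_le {b : ℝ} (hb : 1 < b) {s t s' t' : ℝ} (hs : 0 < s) (ht : 0 < t)
    (hs' : 0 < s') (ht' : 0 < t') :
    logDist (scatter b true false t s) (scatter b true false t' s') +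
      logDist (scatter b false true s t) (scatter b false true s' t')
      ≤ logDist s s' + logDist t t' := by
  by_cases h : t = t'
  · subst h
    simp only [scatter, logDist, mul_div_assoc]
    rw [Real.log_mul (by positivity) (by positivity), Real.log_mul (by positivity) (by positivity)]
    simp
  · exact (step_zero_one hb hs ht hs' ht' h).le

/-- Nonexpansion of the scattering map, in the logarithmic metric. -/
theorem step_le {b : ℝ} (hb : 1 < b) {i j : Bool} (hij : ¬(i = true ∧ j = true)) {s t s' t' : ℝ}
    (hs : 0 < s) (ht : 0 < t) (hs' : 0 < s') (ht' : 0 < t') :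
    logDist (scatter b j i t s) (scatter b j i t' s') +
      logDist (scatter b i j s t) (scatter b i j s' t') ≤ logDist s s' + logDist t t' := by
  cases i <;> cases j
  · refine (step_zero_zero hb hs ht hs' ht').trans (mul_le_of_le_one_left ?_ ?_)
    · exact add_nonneg (logDist_nonneg _ _) (logDist_nonneg _ _)
    · rw [div_le_one (by linarith)]
      linarith
  · exact step_zero_one_le hb hs ht hs' ht'
  · rw [add_comm, add_comm (logDist s s')]
    exact step_zero_one_le hb ht hs ht' hs'
  · simp at hij

theorem step_eq {b : ℝ} (hb : 1 < b) {i j : Bool} (hij : ¬(i = true ∧ j = true)) {s t s' t' : ℝ}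
    (hs : 0 < s) (ht : 0 < t) (hs' : 0 < s') (ht' : 0 < t')
    (h : logDist (scatter b j i t s) (scatter b j i t' s') +
      logDist (scatter b i j s t) (scatter b i j s' t') = logDist s s' + logDist t t') :
    (i = false → t = t') ∧ (j = false → s = s') := by
  cases i <;> cases j
  · have h1 := step_zero_zero hb hs ht hs' ht'
    rw [h] at h1
    have h2 := logDist_nonneg s s'
    have h3 := logDist_nonneg t t'
    have hk : (b - 1) / (b + 1) < 1 := by
      rw [div_lt_one (by linarith)]
      linarith
    have h4 : logDist s s' + logDist t t' = 0 := by nlinarith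
    exact ⟨fun _ => eq_of_logDist_eq_zero ht ht' (by linarith),
      fun _ => eq_of_logDist_eq_zero hs hs' (by linarith)⟩
  · refine ⟨fun _ => ?_, by simp⟩
    by_contra hne
    exact (step_zero_one hb hs ht hs' ht' hne).ne h
  · refine ⟨by simp, fun _ => ?_⟩
    by_contra hne
    rw [add_comm, add_comm (logDist s s')] at h
    exact (step_zero_one hb ht hs ht' hs' hne).ne h
  · simp at hij

section Fixed
variable {ι : Type*}

/-- Simultaneous update of all incoming/outgoing quantities along the permutation `σ`. -/
noncomputable def update (b : ℝ) (σ : Equiv.Perm ι) (w : ι → Bool) (z : (ι → ℝ) × (ι → ℝ)) :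
    (ι → ℝ) × (ι → ℝ) :=
  (fun i => scatter b (w (σ i)) (w i) (z.1 (σ i)) (z.2 i),
   fun i => scatter b (w (σ.symm i)) (w i) (z.2 (σ.symm i)) (z.1 i))

noncomputable def sumLogDist [Fintype ι] (z z' : (ι → ℝ) × (ι → ℝ)) : ℝ :=
  ∑ i, (logDist (z.1 i) (z'.1 i) + logDist (z.2 i) (z'.2 i))

theorem sumLogDist_eq_sum_inputs [Fintype ι] (σ : Equiv.Perm ι) (z z' : (ι → ℝ) × (ι → ℝ)) :
    sumLogDist z z' = ∑ i, (logDist (z.2 i) (z'.2 i) + logDist (z.1 (σ i)) (z'.1 (σ i))) := by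
  simp only [sumLogDist, Finset.sum_add_distrib]
  rw [Equiv.sum_comp σ (fun i => logDist (z.1 i) (z'.1 i)), add_comm]

theorem sumLogDist_eq_sum_outputs [Fintype ι] (σ : Equiv.Perm ι) (z z' : (ι → ℝ) × (ι → ℝ)) :
    sumLogDist z z' = ∑ i, (logDist (z.1 i) (z'.1 i) + logDist (z.2 (σ i)) (z'.2 (σ i))) := by
  simp only [sumLogDist, Finset.sum_add_distrib]
  rw [Equiv.sum_comp σ (fun i => logDist (z.2 i) (z'.2 i))]

def Positive (z : (ι → ℝ) × (ι → ℝ)) : Prop := ∀ i, 0 < z.1 i ∧ 0 < z.2 i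

theorem update_positive {b : ℝ} (hb : 1 < b) {σ : Equiv.Perm ι} {w : ι → Bool}
    {z : (ι → ℝ) × (ι → ℝ)} (hz : Positive z) : Positive (update b σ w z) := fun _ =>
  ⟨scatter_pos hb (hz _).1 (hz _).2, scatter_pos hb (hz _).2 (hz _).1⟩

theorem sum_step_le {b : ℝ} (hb : 1 < b) {σ : Equiv.Perm ι} {w : ι → Bool}
    (hw : ∀ i, ¬(w i = true ∧ w (σ i) = true)) {z z' : (ι → ℝ) × (ι → ℝ)}
    (hz : Positive z) (hz' : Positive z') (i : ι) :
    logDist ((update b σ w z).1 i) ((update b σ w z').1 i) +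
      logDist ((update b σ w z).2 (σ i)) ((update b σ w z').2 (σ i))
      ≤ logDist (z.2 i) (z'.2 i) + logDist (z.1 (σ i)) (z'.1 (σ i)) := by
  simp only [update, Equiv.symm_apply_apply]
  exact step_le hb (hw i) (hz _).2 (hz _).1 (hz' _).2 (hz' _).1

theorem sumLogDist_update_le [Fintype ι] {b : ℝ} (hb : 1 < b) {σ : Equiv.Perm ι} {w : ι → Bool}
    (hw : ∀ i, ¬(w i = true ∧ w (σ i) = true)) {z z' : (ι → ℝ) × (ι → ℝ)}
    (hz : Positive z) (hz' : Positive z') :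
    sumLogDist (update b σ w z) (update b σ w z') ≤ sumLogDist z z' := by
  rw [sumLogDist_eq_sum_outputs σ, sumLogDist_eq_sum_inputs σ z z']
  exact Finset.sum_le_sum fun i _ => sum_step_le hb hw hz hz' i

theorem eq_of_sumLogDist_update_eq [Fintype ι] {b : ℝ} (hb : 1 < b) {σ : Equiv.Perm ι}
    {w : ι → Bool} (hw : ∀ i, ¬(w i = true ∧ w (σ i) = true)) {z z' : (ι → ℝ) × (ι → ℝ)}
    (hz : Positive z) (hz' : Positive z')
    (h : sumLogDist (update b σ w z) (update b σ w z') = sumLogDist z z') (i : ι) :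
    (w i = false → z.1 (σ i) = z'.1 (σ i)) ∧ (w (σ i) = false → z.2 i = z'.2 i) := by
  rw [sumLogDist_eq_sum_outputs σ, sumLogDist_eq_sum_inputs σ z z'] at h
  have h1 := (Finset.sum_eq_sum_iff_of_le fun i _ => sum_step_le hb hw hz hz' i).mp h i
    (Finset.mem_univ i)
  simp only [update, Equiv.symm_apply_apply] at h1
  exact step_eq hb (hw i) (hz _).2 (hz _).1 (hz' _).2 (hz' _).1 h1

theorem update_isFixed_of_sumLogDist_eq [Fintype ι] {b : ℝ} (hb : 1 < b) {σ : Equiv.Perm ι}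
    {w : ι → Bool} (hw : ∀ i, ¬(w i = true ∧ w (σ i) = true)) {z z' : (ι → ℝ) × (ι → ℝ)}
    (hz : Positive z) (hz' : z' = update b σ w z)
    (h : sumLogDist z' (update b σ w z') = sumLogDist z z')
    (h' : sumLogDist (update b σ w z') (update b σ w (update b σ w z')) =
      sumLogDist z' (update b σ w z')) :
    update b σ w z' = z' := by
  have pz' : Positive z' := hz' ▸ update_positive hb hz
  have e1 := eq_of_sumLogDist_update_eq hb hw hz pz' (by rw [← hz', h])
  have e2 := eq_of_sumLogDist_update_eq hb hw pz' (update_positive hb pz') h'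
  have f1 : ∀ i, z'.1 i = (update b σ w z').1 i := by
    intro i
    cases hi : w i
    · have a1 := (e1 i).1 hi
      have l : z'.1 i = scatter b (w (σ i)) (w i) (z.1 (σ i)) (z.2 i) := by rw [hz']; rfl
      rw [l]
      simp only [update]
      cases hj : w (σ i)
      · rw [a1, (e1 i).2 hj]
      · rw [a1, hi]
        rfl
    · have := (e2 (σ.symm i)).1
      simp only [Equiv.apply_symm_apply] at this
      apply this
      have := hw (σ.symm i)
      simp only [Equiv.apply_symm_apply] at this
      simpa [hi] using this
  have f2 : ∀ i, z'.2 (σ i) = (update b σ w z').2 (σ i) := by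
    intro i
    cases hj : w (σ i)
    · have a1 := (e1 i).2 hj
      have l : z'.2 (σ i) = scatter b (w i) (w (σ i)) (z.2 i) (z.1 (σ i)) := by
        rw [hz']; simp [update]
      rw [l]
      simp only [update, Equiv.symm_apply_apply]
      cases hi : w i
      · rw [a1, (e1 i).1 hi]
      · rw [a1, hj]
        rfl
    · apply (e2 (σ i)).2
      have := hw (σ i)
      simpa [hj] using this
  refine Prod.ext (funext fun i => (f1 i).symm) (funext fun i => ?_)
  have := f2 (σ.symm i)
  simpa only [Equiv.apply_symm_apply] using this.symm

theorem continuousOn_update [Fintype ι] {b : ℝ} (hb : 1 < b) (σ : Equiv.Perm ι) (w : ι → Bool) :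
    ContinuousOn (update b σ w) {z | Positive z} := by
  have hs : ∀ (i j : Bool), ContinuousOn (fun p : ℝ × ℝ => scatter b i j p.1 p.2)
      {p | 0 < p.1 ∧ 0 < p.2} := by
    intro i j p hp
    have h1 : 0 < p.1 := hp.1
    have h2 : 0 < p.2 := hp.2
    apply ContinuousAt.continuousWithinAt
    cases i <;> cases j <;> simp only [scatter]
    · exact ContinuousAt.add (by fun_prop) (ContinuousAt.div (by fun_prop) (by fun_prop)
        (by positivity))
    · exact ContinuousAt.div (by fun_prop) (by fun_prop) (by positivity)
    · fun_prop
    · fun_prop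
  refine ContinuousOn.prodMk ?_ ?_
  · refine continuousOn_pi.mpr fun i => ?_
    exact (hs (w (σ i)) (w i)).comp (f := fun z : (ι → ℝ) × (ι → ℝ) => (z.1 (σ i), z.2 i))
      (by fun_prop) fun z hz => ⟨(hz _).1, (hz _).2⟩
  · refine continuousOn_pi.mpr fun i => ?_
    exact (hs (w (σ.symm i)) (w i)).comp
      (f := fun z : (ι → ℝ) × (ι → ℝ) => (z.2 (σ.symm i), z.1 i))
      (by fun_prop) fun z hz => ⟨(hz _).2, (hz _).1⟩

theorem continuousOn_sumLogDist_update [Fintype ι] {b : ℝ} (hb : 1 < b) (σ : Equiv.Perm ι)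
    (w : ι → Bool) :
    ContinuousOn (fun z => sumLogDist z (update b σ w z)) {z | Positive z} := by
  have hu := continuousOn_update hb σ w
  refine continuousOn_finsetSum _ fun i _ => ContinuousOn.add ?_ ?_
  · refine (ContinuousOn.sub (ContinuousOn.log (by fun_prop) fun z hz => (hz i).1.ne')
      (ContinuousOn.log ?_ fun z hz => (update_positive hb hz i).1.ne')).abs
    exact (continuous_apply i).comp_continuousOn (continuous_fst.comp_continuousOn hu)
  · refine (ContinuousOn.sub (ContinuousOn.log (by fun_prop) fun z hz => (hz i).2.ne')
      (ContinuousOn.log ?_ fun z hz => (update_positive hb hz i).2.ne')).abs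
    exact (continuous_apply i).comp_continuousOn (continuous_snd.comp_continuousOn hu)

noncomputable def lowerBd (b : ℝ) (i : Bool) : ℝ := if i then 1 / b else 1

/-- Existence of a fixed point of the update map: it does not expand `sumLogDist`, and preserves a
compact box cut out by `B` and `C`. -/
theorem exists_update_fixed [Fintype ι] {b : ℝ} (hb : 1 < b) (σ : Equiv.Perm ι)
    (w : ι → Bool) (hw : ∀ i, ¬(w i = true ∧ w (σ i) = true)) (B C : ι → ℝ)
    (hB1 : ∀ i, b ≤ B i) (hC1 : ∀ i, b ≤ C i)
    (hB : ∀ i, (w i = false ∧ w (σ i) = false) ∨ B (σ i) + b + 1 ≤ B i)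
    (hC : ∀ i, (w i = false ∧ w (σ i) = false) ∨ C i + b + 1 ≤ C (σ i)) :
    ∃ z, Positive z ∧ update b σ w z = z := by
  set K : Set ((ι → ℝ) × (ι → ℝ)) :=
    Set.Icc (fun i => lowerBd b (w i), fun i => lowerBd b (w i)) (B, C) with hK
  have hb0 : (0 : ℝ) < b := by linarith
  have hbinv : 1 / b ≤ 1 := by rw [div_le_one hb0]; exact hb.le
  have hL0 : ∀ i, 0 < lowerBd b i := by
    intro i
    cases i <;> simp only [lowerBd] <;> norm_num
    exact hb0
  have hLle : ∀ i, lowerBd b i ≤ 1 := by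
    intro i
    cases i <;> simp only [lowerBd] <;> norm_num
    rw [← one_div]; exact hbinv
  have hKpos : ∀ z ∈ K, Positive z := fun z hz i =>
    ⟨(hL0 _).trans_le (hz.1.1 i), (hL0 _).trans_le (hz.1.2 i)⟩
  have bound : ∀ (i j : Bool) (s t S T : ℝ), ¬(i = true ∧ j = true) → lowerBd b i ≤ s →
      lowerBd b j ≤ t → s ≤ S → b ≤ T → ((i = false ∧ j = false) ∨ S + b + 1 ≤ T) →
      lowerBd b j ≤ scatter b i j s t ∧ scatter b i j s t ≤ T := by
    intro i j s t S T hij hs ht hS hT hST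
    have hs0 := (hL0 i).trans_le hs
    have ht0 := (hL0 j).trans_le ht
    have hb1 := sub_pos.mpr hb
    cases i <;> cases j <;> simp only [scatter, lowerBd] at * <;> simp at hij hST ⊢
    · constructor
      · positivity
      · refine le_trans ?_ hT
        have : (b - 1) * t / (s + t) ≤ b - 1 := by
          rw [div_le_iff₀ (by positivity)]
          nlinarith
        linarith
    · constructor
      · rw [← one_div, div_le_div_iff₀ hb0 (by positivity)]
        simp at hs
        nlinarith [mul_pos hs0 ht0, mul_pos hb0 ht0, mul_pos hs0 hb0]
      · have : s * (t + 1) / (t + b) ≤ s := by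
          rw [div_le_iff₀ (by positivity)]
          nlinarith
        linarith
    · constructor <;> linarith
  have hmaps : ∀ z ∈ K, update b σ w z ∈ K := by
    intro z hz
    have h1 : ∀ i, lowerBd b (w i) ≤ (update b σ w z).1 i ∧ (update b σ w z).1 i ≤ B i := by
      intro i
      exact bound _ _ _ _ (B (σ i)) (B i) (fun h => hw i h.symm) (hz.1.1 _) (hz.1.2 _)
        (hz.2.1 _) (hB1 i) ((hB i).imp_left And.symm)
    have h2 : ∀ i, lowerBd b (w i) ≤ (update b σ w z).2 i ∧ (update b σ w z).2 i ≤ C i := by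
      intro i
      have h3 := hw (σ.symm i)
      have h4 := hC (σ.symm i)
      simp only [Equiv.apply_symm_apply] at h3 h4
      exact bound _ _ _ _ (C (σ.symm i)) (C i) h3 (hz.1.2 _) (hz.1.1 _) (hz.2.2 _) (hC1 i) h4
    exact ⟨⟨fun i => (h1 i).1, fun i => (h2 i).1⟩, ⟨fun i => (h1 i).2, fun i => (h2 i).2⟩⟩
  have hne : K.Nonempty := Set.nonempty_Icc.mpr
    ⟨fun i => (hLle _).trans (hb.le.trans (hB1 i)), fun i => (hLle _).trans (hb.le.trans (hC1 i))⟩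
  obtain ⟨z, hz, hmin⟩ := (isCompact_Icc : IsCompact K).exists_isMinOn hne
    ((continuousOn_sumLogDist_update hb σ w).mono hKpos)
  have hz1 := hmaps z hz
  have hz2 := hmaps _ hz1
  have hz3 := hmaps _ hz2
  have m1 := isMinOn_iff.mp hmin _ hz1
  have m2 := isMinOn_iff.mp hmin _ hz2
  have l1 := sumLogDist_update_le hb hw (hKpos _ hz) (hKpos _ hz1)
  have l2 := sumLogDist_update_le hb hw (hKpos _ hz1) (hKpos _ hz2)
  exact ⟨update b σ w z, hKpos _ hz1,
    update_isFixed_of_sumLogDist_eq hb hw (hKpos _ hz) rfl (le_antisymm l1 m1)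
      (le_antisymm l2 (by linarith))⟩

end Fixed

/-- A bi-infinite positive solution of the scattering relations along the word `w`. -/
def ScatterOrbit (b : ℝ) (w : ℤ → Bool) (u v : ℤ → ℝ) : Prop :=
  ∀ n, 0 < u n ∧ 0 < v n ∧ ¬(w n = true ∧ w (n + 1) = true) ∧
    u n = scatter b (w (n + 1)) (w n) (u (n + 1)) (v n) ∧
    v (n + 1) = scatter b (w n) (w (n + 1)) (v n) (u (n + 1))

def IsDoubleZero (w : ℤ → Bool) (n : ℤ) : Prop := w n = false ∧ w (n + 1) = false

theorem ZMod.val_eq_val_sub_one_add_one {m : ℕ} [NeZero m] {j : ZMod m} (hj : j ≠ 0) :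
    j.val = (j - 1).val + 1 := by
  have hm : 1 < m := by
    have := NeZero.pos m
    by_contra h
    obtain rfl : m = 1 := by omega
    exact hj (Subsingleton.elim _ _)
  have : Fact (1 < m) := ⟨hm⟩
  have h1 : 1 ≤ j.val := Nat.one_le_iff_ne_zero.mpr (by rwa [Ne, ZMod.val_eq_zero])
  rw [ZMod.val_sub (by rwa [ZMod.val_one]), ZMod.val_one]
  omega

theorem exists_periodic_scatterOrbit {b : ℝ} (hb : 1 < b) {w : ℤ → Bool}
    (hw : ∀ n, ¬(w n = true ∧ w (n + 1) = true)) {k l : ℤ} (hkl : k < l)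
    (hk : IsDoubleZero w k) (hl : w l = false) :
    ∃ (w' : ℤ → Bool) (u v : ℤ → ℝ) (m : ℕ), 1 ≤ m ∧ ScatterOrbit b w' u v ∧
      (∀ n, w' (n + m) = w' n ∧ u (n + m) = u n ∧ v (n + m) = v n) ∧
      (∀ n, k ≤ n → n ≤ l → w' n = w n) ∧ IsDoubleZero w' l := by
  obtain ⟨m, hm⟩ : ∃ m : ℕ, (m : ℤ) = l - k := ⟨(l - k).toNat, by omega⟩
  have hm1 : 1 ≤ m := by omega
  have : NeZero m := ⟨by omega⟩
  set W : ZMod m → Bool := fun i => w (k + i.val) with hW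
  have hW0 : W 0 = false := by simpa [hW] using hk.1
  have hWcast : ∀ n : ℤ, k ≤ n → n ≤ l → W ((n - k : ℤ) : ZMod m) = w n := by
    intro n h1 h2
    rcases h2.lt_or_eq with h2 | h2
    · simp only [hW]
      rw [ZMod.val_intCast, Int.emod_eq_of_lt (by omega) (by omega)]
      congr 1
      ring
    · have : ((n - k : ℤ) : ZMod m) = 0 := by
        rw [h2, ← hm]
        simp
      rw [this, hW0, h2, hl]
  have hW1 : W 1 = false := by
    have := hWcast (k + 1) (by omega) (by omega)
    rw [hk.2] at this
    simpa using this
  have hno : ∀ i, ¬(W i = true ∧ W (i + 1) = true) := by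
    intro i
    by_cases h : i + 1 = 0
    · simp [h, hW0]
    · have := ZMod.val_eq_val_sub_one_add_one h
      simp only [add_sub_cancel_right] at this
      simp only [hW, this]
      have := hw (k + i.val)
      push_cast
      rwa [add_assoc] at this
  have hb1 : 0 < b + 1 := by linarith
  obtain ⟨z, hz, hfix⟩ := exists_update_fixed hb (Equiv.addRight (1 : ZMod m)) W hno
    (fun i => b + (b + 1) * ((-i).val : ℝ)) (fun i => b + (b + 1) * ((i - 1).val : ℝ))
    (fun i => le_add_of_nonneg_right (by positivity))
    (fun i => le_add_of_nonneg_right (by positivity))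
    (fun i => by
      by_cases h : i = 0
      · left
        simp [h, hW0, hW1]
      · right
        have := ZMod.val_eq_val_sub_one_add_one (neg_ne_zero.mpr h)
        simp only [Equiv.coe_addRight]
        rw [this, show -(i + 1) = -i - 1 by ring]
        push_cast
        linarith)
    (fun i => by
      by_cases h : i = 0
      · left
        simp [h, hW0, hW1]
      · right
        have := ZMod.val_eq_val_sub_one_add_one h
        simp only [Equiv.coe_addRight, add_sub_cancel_right]
        rw [this]
        push_cast
        linarith)
  have hcast : ∀ n : ℤ, ((n + 1 - k : ℤ) : ZMod m) = ((n - k : ℤ) : ZMod m) + 1 := by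
    intro n
    push_cast
    ring
  have hper : ∀ n : ℤ, ((n + m - k : ℤ) : ZMod m) = ((n - k : ℤ) : ZMod m) := by
    intro n
    push_cast
    simp
  refine ⟨fun n => W ((n - k : ℤ) : ZMod m), fun n => z.1 ((n - k : ℤ) : ZMod m),
    fun n => z.2 ((n - k : ℤ) : ZMod m), m, hm1, ?_, ?_, hWcast, ?_⟩
  · intro n
    simp only [hcast]
    generalize ((n - k : ℤ) : ZMod m) = i
    refine ⟨(hz i).1, (hz i).2, hno i, ?_, ?_⟩
    · exact (congrFun (congrArg Prod.fst hfix) i).symm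
    · have := (congrFun (congrArg Prod.snd hfix) (i + 1)).symm
      simpa [update] using this
  · intro n
    simp only [hper, and_self]
  · have : ((l - k : ℤ) : ZMod m) = 0 := by
      rw [← hm]
      simp
    simp only [IsDoubleZero, hcast, this, zero_add, hW0, hW1, and_self]

/-! ### Recurrence of double zeros -/

theorem no_escaping_sequence {b : ℝ} (hb : 1 < b) (s V : ℕ → ℝ) (hs : ∀ k, 0 < s k)
    (hV : ∀ k, 0 < V k) (h1 : ∀ k, V k + 2 / s k ≤ V (k + 1))
    (h2 : ∀ k, s (k + 1) ≤ s k - (b + 1) + (b - 1) / V (k + 1)) : False := by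
  have hmono : Monotone V := monotone_nat_of_le_succ fun k => by
    have := h1 k
    have : 0 < 2 / s k := div_pos two_pos (hs k)
    linarith
  set A := (b - 1) / V 0 with hA
  have hA0 : 0 ≤ A := div_nonneg (by linarith) (hV 0).le
  have hlin : ∀ k : ℕ, s k ≤ s 0 + k * A := by
    intro k
    induction k with
    | zero => simp
    | succ k ih =>
      have : (b - 1) / V (k + 1) ≤ A :=
        div_le_div_of_nonneg_left (by linarith) (hV 0) (hmono (Nat.zero_le _))
      have := h2 k
      push_cast
      linarith
  set D := s 0 + A with hD
  have hD0 : 0 < D := add_pos_of_pos_of_nonneg (hs 0) hA0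
  have hlin' : ∀ k : ℕ, s k ≤ D * (k + 1) := by
    intro k
    have := hlin k
    have := mul_nonneg (Nat.cast_nonneg (α := ℝ) k) (hs 0).le
    rw [hD]
    linarith
  have hsum : ∀ k : ℕ, 2 / D * ∑ i ∈ Finset.range k, 1 / ((i : ℝ) + 1) ≤ V k := by
    intro k
    induction k with
    | zero => simpa using (hV 0).le
    | succ k ih =>
      rw [Finset.sum_range_succ, mul_add]
      have : 2 / D * (1 / ((k : ℝ) + 1)) ≤ 2 / s k := by
        rw [div_mul_div_comm, mul_one]
        exact div_le_div_of_nonneg_left two_pos.le (hs k) (hlin' k)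
      have := h1 k
      linarith
  obtain ⟨K, hK⟩ := ((Real.tendsto_sum_range_one_div_nat_succ_atTop.const_mul_atTop
    (div_pos two_pos hD0)).eventually_ge_atTop 1).exists
  have hdec : ∀ j : ℕ, s (K + j) ≤ s K - 2 * j := by
    intro j
    induction j with
    | zero => simp
    | succ j ih =>
      have hV1 : 1 ≤ V (K + j + 1) := (hK.trans (hsum K)).trans (hmono (by omega))
      have : (b - 1) / V (K + j + 1) ≤ b - 1 := div_le_self (by linarith) hV1
      have := h2 (K + j)
      rw [← add_assoc]
      push_cast
      linarith
  obtain ⟨j, hj⟩ := exists_nat_gt (s K)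
  have := hdec j
  have := hs (K + j)
  have := Nat.cast_nonneg (α := ℝ) j
  linarith

theorem ScatterOrbit.exists_isDoubleZero_ge {b : ℝ} (hb : 1 < b) {w : ℤ → Bool} {u v : ℤ → ℝ}
    (h : ScatterOrbit b w u v) (n : ℤ) : ∃ k, n ≤ k ∧ IsDoubleZero w k := by
  by_contra! hno
  have alt : ∀ k, n ≤ k → w k = false → w (k + 1) = true := by
    intro k hk h0
    by_contra h1
    exact hno k hk ⟨h0, by simpa using h1⟩
  have alt' : ∀ k, w k = true → w (k + 1) = false := by
    intro k h0
    have := (h k).2.2.1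
    simpa [h0] using this
  obtain ⟨k, hk, hk0, hk1⟩ : ∃ k, n ≤ k ∧ w k = true ∧ w (k + 1) = false := by
    cases h0 : w n
    · exact ⟨n + 1, by omega, alt n le_rfl h0, alt' _ (alt n le_rfl h0)⟩
    · exact ⟨n, le_rfl, h0, alt' _ h0⟩
  have hword : ∀ j : ℕ, w (k + 2 * j) = true := by
    intro j
    induction j with
    | zero => simpa using hk0
    | succ j ih =>
      have := alt _ (by omega) (alt' _ ih)
      convert this using 2
      push_cast
      ring
  refine no_escaping_sequence hb (fun j => u (k + 2 * j + 1))
    (fun j => (v (k + 2 * j + 1) - 1) / u (k + 2 * j + 1)) (fun j => (h _).1) ?_ ?_ ?_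
  · intro j
    have h1 := (h (k + 2 * j)).2.2.2.2
    rw [hword j, alt' _ (hword j)] at h1
    simp only [scatter] at h1
    have := (h (k + 2 * j)).2.1
    exact div_pos (by linarith) (h _).1
  all_goals
    intro j
    have w1 := alt' _ (hword j)
    have w2 := hword (j + 1)
    have w3 := alt' _ w2
    have a1 := h (k + 2 * j + 1)
    have e : k + 2 * ((j + 1 : ℕ) : ℤ) = k + 2 * j + 1 + 1 := by push_cast; ring
    rw [e] at w2 w3
    have a2 := h (k + 2 * j + 1 + 1)
    rw [e]
    have a3 := h (k + 2 * j + 1 + 1 + 1)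
    generalize k + 2 * (j : ℤ) + 1 = i at *
    rw [w1, w2] at a1
    rw [w2, w3] at a2
    simp only [scatter] at a1 a2
    obtain ⟨p1, p2, -, e1, e2⟩ := a1
    obtain ⟨p3, p4, -, e3, e4⟩ := a2
    obtain ⟨p5, p6, -⟩ := a3
    generalize u i = s, v i = y, u (i + 1) = x, v (i + 1) = t, u (i + 1 + 1) = s',
      v (i + 1 + 1) = y' at *
    have q1 : 0 < t + b := by linarith
    have q2 : s' = x * (t + b) / (t + 1) := by
      rw [e3]
      field_simp
    have q3 : (y' - 1) / s' = (t + 1) / x := by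
      rw [e4, q2]
      field_simp
      ring
    rw [q3]
  · have q4 : 0 < x + b := by linarith
    rw [e1, e2, ← add_div, div_le_div_iff₀ (by positivity) p3, ← sub_nonneg]
    have : (y * (x + 1) / (x + b) + 1) * (x + b + 1) - (y - 1 + 2) * x
        = (y * ((x + 1) * (x + b + 1) - x * (x + b)) + (x + b) * (b + 1)) / (x + b) := by
      field_simp
      ring
    rw [this]
    apply div_nonneg _ q4.le
    have : 0 < (x + 1) * (x + b + 1) - x * (x + b) := by nlinarith
    positivity
  · have : x * (t + b) / (t + 1) = x + b + 1 - (b + 1) + (b - 1) / ((t + 1) / x) := by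
      field_simp
      ring
    rw [q2, e1, this]

theorem ScatterOrbit.reverse {b : ℝ} {w : ℤ → Bool} {u v : ℤ → ℝ} (h : ScatterOrbit b w u v) :
    ScatterOrbit b (fun n => w (-n)) (fun n => v (-n)) (fun n => u (-n)) := by
  intro n
  obtain ⟨-, -, h3, h4, h5⟩ := h (-n - 1)
  rw [sub_add_cancel] at h3 h4 h5
  simp only [show -(n + 1) = -n - 1 by ring]
  exact ⟨(h _).2.1, (h _).1, fun h' => h3 h'.symm, h5, h4⟩

theorem ScatterOrbit.exists_isDoubleZero_le {b : ℝ} (hb : 1 < b) {w : ℤ → Bool} {u v : ℤ → ℝ}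
    (h : ScatterOrbit b w u v) (n : ℤ) : ∃ k, k ≤ n ∧ IsDoubleZero w k := by
  obtain ⟨k, hk, h1, h2⟩ := h.reverse.exists_isDoubleZero_ge hb (-n + 1)
  refine ⟨-k - 1, by omega, ?_, ?_⟩
  · simpa [neg_add, sub_eq_add_neg, add_comm] using h2
  · simpa using h1

/-! ### Expansion of the difference of two orbits with the same word -/

theorem le_of_forall_step {Q : ℤ → ℝ} {k l : ℤ} (hkl : k ≤ l)
    (h : ∀ n, k ≤ n → n < l → Q n ≤ Q (n + 1)) : Q k ≤ Q l := by
  induction l, hkl using Int.leInduction with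
  | base => exact le_rfl
  | succ n hn ih => exact (ih fun i h1 h2 => h i h1 (by omega)).trans (h n hn (by omega))

/-- Geometric growth of a monotone sequence gaining a factor `1 + δ` on a recurrent set `S`. -/
theorem exists_forall_pow_mul_le {S : ℤ → Prop} (hS : ∀ n, ∃ k, n ≤ k ∧ S k) (δ : ℝ)
    (hδ : 0 < δ) (k : ℤ) (j : ℕ) :
    ∃ l, k ≤ l ∧ S l ∧ ∀ Q : ℤ → ℝ, (∀ n, k ≤ n → n < l → Q n ≤ Q (n + 1)) →
      (∀ n, k ≤ n → n < l → S n → (1 + δ) * Q n ≤ Q (n + 1)) → (1 + δ) ^ j * Q k ≤ Q l := by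
  induction j with
  | zero =>
    obtain ⟨l, hl, hSl⟩ := hS k
    refine ⟨l, hl, hSl, fun Q h1 _ => ?_⟩
    simpa using le_of_forall_step hl h1
  | succ j ih =>
    obtain ⟨l, hl, hSl, hQ⟩ := ih
    obtain ⟨l', hl', hSl'⟩ := hS (l + 1)
    refine ⟨l', by omega, hSl', fun Q h1 h2 => ?_⟩
    have a1 := hQ Q (fun n hn hn' => h1 n hn (by omega)) (fun n hn hn' => h2 n hn (by omega))
    have a2 := h2 l hl (by omega) hSl
    have a3 := le_of_forall_step hl' fun n hn hn' => h1 n (by omega) hn'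
    have a4 := mul_le_mul_of_nonneg_left a1 (by linarith : 0 ≤ 1 + δ)
    rw [pow_succ']
    linarith

theorem logDist_le_log {b x y : ℝ} (hx : 1 ≤ x) (hx' : x ≤ b) (hy : 1 ≤ y)
    (hy' : y ≤ b) : logDist x y ≤ Real.log b := by
  have h1 := Real.log_nonneg hx
  have h2 := Real.log_nonneg hy
  have h3 := Real.log_le_log (by linarith) hx'
  have h4 := Real.log_le_log (by linarith) hy'
  unfold logDist
  rw [abs_le]
  constructor <;> linarith

theorem scatter_zero_zero_mem {b : ℝ} (hb : 1 < b) {s t : ℝ} (hs : 0 < s) (ht : 0 < t) :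
    1 ≤ scatter b false false s t ∧ scatter b false false s t ≤ b := by
  have := sub_pos.mpr hb
  simp only [scatter]
  constructor
  · have : 0 ≤ (b - 1) * t / (s + t) := by positivity
    linarith
  · have : (b - 1) * t / (s + t) ≤ b - 1 := by
      rw [div_le_iff₀ (by positivity)]
      nlinarith
    linarith

theorem ScatterOrbit.mem_of_isDoubleZero {b : ℝ} (hb : 1 < b) {w : ℤ → Bool} {u v : ℤ → ℝ}
    (h : ScatterOrbit b w u v) {n : ℤ} (hn : IsDoubleZero w n) :
    (1 ≤ u n ∧ u n ≤ b) ∧ 1 ≤ v (n + 1) ∧ v (n + 1) ≤ b := by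
  have h1 := (h n).2.2.2
  rw [hn.1, hn.2] at h1
  rw [h1.1, h1.2]
  exact ⟨scatter_zero_zero_mem hb (h _).1 (h _).2.1, scatter_zero_zero_mem hb (h _).2.1 (h _).1⟩

/-- An indefinite form in the logarithmic differences of two orbits, nondecreasing in time. -/
noncomputable def logForm (u v u' v' : ℤ → ℝ) (n : ℤ) : ℝ :=
  logDist (u n) (u' n) - logDist (v n) (v' n)

theorem logForm_step {b : ℝ} (hb : 1 < b) {w w' : ℤ → Bool} {u v u' v' : ℤ → ℝ}
    (h : ScatterOrbit b w u v) (h' : ScatterOrbit b w' u' v') {n : ℤ} (h0 : w n = w' n)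
    (h1 : w (n + 1) = w' (n + 1)) : logForm u v u' v' n ≤ logForm u v u' v' (n + 1) := by
  obtain ⟨-, p1, p2, p3, p4⟩ := h n
  obtain ⟨-, q1, q2, q3, q4⟩ := h' n
  have := step_le hb p2 p1 (h (n + 1)).1 q1 (h' (n + 1)).1
  rw [← p3, ← p4, h0, h1, ← q3, ← q4] at this
  unfold logForm
  linarith

theorem logForm_step_zero_zero {b : ℝ} (hb : 1 < b) {w w' : ℤ → Bool} {u v u' v' : ℤ → ℝ}
    (h : ScatterOrbit b w u v) (h' : ScatterOrbit b w' u' v') {n : ℤ} (h0 : w n = w' n)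
    (h1 : w (n + 1) = w' (n + 1)) (hn : IsDoubleZero w n) :
    (1 + 2 / (b + 1)) * logForm u v u' v' n ≤ logForm u v u' v' (n + 1) ∧
    logForm u v u' v' n ≤ (1 + 2 / (b + 1)) * logForm u v u' v' (n + 1) ∧
    2 / (b + 1) * (logDist (u n) (u' n) + logDist (v n) (v' n)) ≤
      2 * (logForm u v u' v' (n + 1) - logForm u v u' v' n) := by
  obtain ⟨-, p1, p2, p3, p4⟩ := h n
  obtain ⟨-, q1, q2, q3, q4⟩ := h' n
  have key := step_zero_zero hb p1 (h (n + 1)).1 q1 (h' (n + 1)).1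
  rw [← h0, ← h1] at q3 q4
  rw [hn.1, hn.2] at p3 p4 q3 q4
  rw [← p3, ← p4, ← q3, ← q4, show (b - 1) / (b + 1) = 1 - 2 / (b + 1) by
    field_simp
    ring] at key
  have hδ : 0 < 2 / (b + 1) := by positivity
  have hδ1 : 2 / (b + 1) ≤ 1 := by
    rw [div_le_one (by linarith)]
    linarith
  unfold logForm
  have n1 := logDist_nonneg (u n) (u' n)
  have n2 := logDist_nonneg (v n) (v' n)
  have n3 := logDist_nonneg (u (n + 1)) (u' (n + 1))
  have n4 := logDist_nonneg (v (n + 1)) (v' (n + 1))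
  generalize 2 / (b + 1) = δ at *
  generalize logDist (u n) (u' n) = x, logDist (v n) (v' n) = y,
    logDist (u (n + 1)) (u' (n + 1)) = x', logDist (v (n + 1)) (v' (n + 1)) = y' at *
  have m1 := mul_nonneg hδ.le n1
  have m2 := mul_nonneg hδ.le n2
  have m3 := mul_nonneg hδ.le n3
  have m4 := mul_nonneg hδ.le n4
  have m5 : δ * (x + y') ≤ δ * (y + x') :=
    mul_le_mul_of_nonneg_left (by linarith) hδ.le
  refine ⟨?_, ?_, ?_⟩ <;> linarith

/-- Orbits with the same word on a long enough window around a double zero are close there. -/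
theorem ScatterOrbit.exists_window {b : ℝ} (hb : 1 < b) {w : ℤ → Bool} {u v : ℤ → ℝ}
    (h : ScatterOrbit b w u v) {n : ℤ} (hn : IsDoubleZero w n) {ε : ℝ} (hε : 0 < ε) :
    ∃ k l, k < n ∧ n < l ∧ IsDoubleZero w k ∧ IsDoubleZero w l ∧
      ∀ w' u' v', ScatterOrbit b w' u' v' → (∀ i, k ≤ i → i ≤ l → w' i = w i) →
        IsDoubleZero w' l → logDist (u n) (u' n) < ε ∧ logDist (v n) (v' n) < ε := by
  set δ := 2 / (b + 1) with hδ
  have hδ0 : 0 < δ := by positivity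
  have hlog : 0 < Real.log b := Real.log_pos hb
  obtain ⟨j, hj⟩ := exists_pow_lt_of_lt_one
    (show 0 < δ * ε / (4 * Real.log b) by positivity)
    (show 1 / (1 + δ) < 1 by rw [div_lt_one (by linarith)]; linarith)
  have hpow : 0 < (1 + δ) ^ j := by positivity
  rw [div_pow, one_pow, div_lt_div_iff₀ hpow (by positivity), one_mul] at hj
  obtain ⟨l, hl, hSl, hQl⟩ := exists_forall_pow_mul_le (S := IsDoubleZero w)
    (h.exists_isDoubleZero_ge hb) δ hδ0 (n + 1) j
  obtain ⟨k, hk, hSk, hQk⟩ := exists_forall_pow_mul_le (S := fun i => IsDoubleZero w (-i))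
    (fun i => by
      obtain ⟨k, hk, hS⟩ := h.exists_isDoubleZero_le hb (-i)
      exact ⟨-k, by omega, by simpa using hS⟩) δ hδ0 (-n + 1) j
  refine ⟨-k, l, by omega, by omega, hSk, hSl, fun w' u' v' h' hw hl' => ?_⟩
  have hmono : ∀ i, -k ≤ i → i < l → logForm u v u' v' i ≤ logForm u v u' v' (i + 1) :=
    fun i h1 h2 => logForm_step hb h h' (hw i h1 (by omega)).symm (hw _ (by omega) (by omega)).symm
  have hgain := fun i (h1 : -k ≤ i) (h2 : i < l) (h3 : IsDoubleZero w i) =>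
    logForm_step_zero_zero hb h h' (hw i h1 (by omega)).symm (hw _ (by omega) (by omega)).symm h3
  have a1 := hQl (logForm u v u' v') (fun i h1 h2 => hmono i (by omega) h2)
    (fun i h1 h2 h3 => (hgain i (by omega) h2 h3).1)
  have a2 := hQk (fun i => -logForm u v u' v' (-i + 1))
    (fun i h1 h2 => by
      have := hmono (-i) (by omega) (by omega)
      rw [show -(i + 1) + 1 = -i by ring]
      linarith)
    (fun i h1 h2 h3 => by
      have := (hgain (-i) (by omega) (by omega) h3).2.1
      rw [show -(i + 1) + 1 = -i by ring]
      linarith)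
  have hSk' : IsDoubleZero w' (-k) :=
    ⟨(hw _ le_rfl (by omega)).trans hSk.1, (hw _ (by omega) (by omega)).trans hSk.2⟩
  have b1 : logForm u v u' v' l ≤ Real.log b := by
    have c1 := (h.mem_of_isDoubleZero hb hSl).1
    have c2 := (h'.mem_of_isDoubleZero hb hl').1
    have c3 := logDist_le_log c1.1 c1.2 c2.1 c2.2
    have c4 := logDist_nonneg (v l) (v' l)
    unfold logForm
    linarith
  have b2 : -Real.log b ≤ logForm u v u' v' (-k + 1) := by
    have c1 := (h.mem_of_isDoubleZero hb hSk).2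
    have c2 := (h'.mem_of_isDoubleZero hb hSk').2
    have c3 := logDist_le_log c1.1 c1.2 c2.1 c2.2
    have c4 := logDist_nonneg (u (-k + 1)) (u' (-k + 1))
    unfold logForm
    linarith
  have a3 := (hgain n (by omega) (by omega) hn).2.2
  rw [← hδ] at a3
  simp only [show -(-n + 1) + 1 = n by ring] at a2
  have n1 := logDist_nonneg (u n) (u' n)
  have n2 := logDist_nonneg (v n) (v' n)
  have hsum : logDist (u n) (u' n) + logDist (v n) (v' n) < ε := by
    have e1 : (1 + δ) ^ j * (δ * (logDist (u n) (u' n) + logDist (v n) (v' n))) ≤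
        4 * Real.log b := by
      have := mul_le_mul_of_nonneg_left a3 hpow.le
      linarith
    have e2 : (1 + δ) ^ j * (δ * (logDist (u n) (u' n) + logDist (v n) (v' n))) <
        (1 + δ) ^ j * (δ * ε) := by linarith
    exact lt_of_mul_lt_mul_left (lt_of_mul_lt_mul_left e2 hpow.le) hδ0.le
  constructor <;> linarith

/-! ### Translation between planar orbits and scattering orbits -/

/-- The point of `R₀` or `R₁` with the given scattering coordinates. -/
def place (i : Bool) (s t : ℝ) : ℝ × ℝ := if i then (-t, s) else (s, -t)

theorem ScatterOrbit.birat_place {a : ℝ} (ha : a < -1) {w : ℤ → Bool} {u v : ℤ → ℝ}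
    (h : ScatterOrbit (-a) w u v) (n : ℤ) :
    (place (w n) (u n) (v n)).1 ≠ 1 ∧ birat a (place (w n) (u n) (v n)) =
      place (w (n + 1)) (u (n + 1)) (v (n + 1)) := by
  obtain ⟨p1, p2, p3, p4, p5⟩ := h n
  obtain ⟨p6, p7, -⟩ := h (n + 1)
  obtain ⟨b, rfl⟩ : ∃ b, a = -b := ⟨-a, by simp⟩
  rw [neg_neg] at p4 p5
  have hb : 0 < b - 1 := by linarith
  have hb0 : 0 < b := by linarith
  generalize u n = s, v n = t, u (n + 1) = s', v (n + 1) = t' at *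
  generalize w n = i, w (n + 1) = j at *
  cases i <;> cases j <;> simp only [scatter, place, birat, if_true, if_false, Bool.false_eq_true]
    at *
  · have hs : s - 1 = (b - 1) * t / (s' + t) := by rw [p4]; ring
    have hs1 : 0 < (b - 1) * t / (s' + t) := by positivity
    refine ⟨by linarith, Prod.ext ?_ ?_⟩
    · simp only
      rw [hs, p4]
      field_simp
      ring
    · simp only
      rw [p4, p5]
      field_simp
      ring
  · refine ⟨by linarith, Prod.ext ?_ ?_⟩
    · simp only
      rw [p4, p5]
      have : s' + b + 1 - 1 ≠ 0 := by linarith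
      field_simp
      ring
    · simp only
      linarith
  · refine ⟨by linarith, Prod.ext ?_ ?_⟩
    · simp only
      rw [p4]
      have : -t - 1 ≠ 0 := by linarith
      field_simp
      ring
    · simp only
      linarith
  · simp at p3

theorem exists_scatterOrbit {a : ℝ} (ha : a < -1) {p : ℤ → ℝ × ℝ}
    (horb : ∀ n : ℤ, (p n).1 ≠ 1 ∧ p (n + 1) = birat a (p n))
    (hR : ∀ n : ℤ, p n ∈ Rzero ∪ Rone) :
    ∃ w u v, ScatterOrbit (-a) w u v ∧ ∀ n, p n = place (w n) (u n) (v n) := by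
  have hx : ∀ n, (p (n + 1)).1 = (p n).2 * ((p n).1 + a) / ((p n).1 - 1) := fun n => by
    rw [(horb n).2]; rfl
  have hy : ∀ n, (p (n + 1)).2 = (p n).1 + a - 1 := fun n => by rw [(horb n).2]; rfl
  have zero : ∀ n, ¬(p n).1 ≤ 0 → 1 < (p n).1 ∧ (p n).2 ≤ -1 := by
    intro n hn
    rcases hR n with h | h
    · exact ⟨lt_of_le_of_ne h.1 (horb n).1.symm, h.2⟩
    · exact absurd h.1 hn
  have one : ∀ n, (p n).1 ≤ 0 → 0 ≤ (p n).2 := by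
    intro n hn
    rcases hR n with h | h
    · exact absurd (h.1.trans hn) (by norm_num)
    · exact h.2
  have no : ∀ n, (p n).1 ≤ 0 → ¬(p (n + 1)).1 ≤ 0 := by
    intro n hn hn'
    have := one _ hn'
    rw [hy] at this
    linarith
  have one' : ∀ n, (p n).1 ≤ 0 → (p n).1 < 0 ∧ 0 < (p n).2 := by
    intro n hn
    constructor
    · refine lt_of_le_of_ne hn fun h0 => ?_
      obtain ⟨k, rfl⟩ : ∃ k, n = k + 1 := ⟨n - 1, by ring⟩
      have h1 := one _ hn
      have h2 : ¬(p k).1 ≤ 0 := fun h => no k h hn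
      have h3 := zero k h2
      rw [hx] at h0
      rw [hy] at h1
      have h4 : (p k).2 * ((p k).1 + a) < 0 := mul_neg_of_neg_of_pos (by linarith) (by linarith)
      exact (div_neg_of_neg_of_pos h4 (by linarith)).ne h0
    · refine lt_of_le_of_ne (one n hn) fun h0 => no n hn ?_
      rw [hx, ← h0]
      simp
  refine ⟨fun n => decide ((p n).1 ≤ 0), fun n => if (p n).1 ≤ 0 then (p n).2 else (p n).1,
    fun n => if (p n).1 ≤ 0 then -(p n).1 else -(p n).2, fun n => ?_, fun n => ?_⟩
  · have hx := hx n
    have hy := hy n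
    have d0 : (p n).1 - 1 ≠ 0 := sub_ne_zero.mpr (horb n).1
    by_cases h : (p n).1 ≤ 0 <;> by_cases h' : (p (n + 1)).1 ≤ 0
    · exact absurd h' (no n h)
    · have h1 := one' n h
      have h2 := zero _ h'
      simp only [h, h', if_true, if_false, decide_true, decide_false, scatter]
      generalize (p n).1 = x, (p n).2 = y, (p (n + 1)).1 = x', (p (n + 1)).2 = y' at *
      have d1 : -x + -a ≠ 0 := by linarith
      refine ⟨h1.2, by linarith, by simp, ?_, by linarith⟩
      rw [hx, eq_div_iff d1]
      field_simp
      ring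
    · have h1 := zero n h
      have h2 := one' _ h'
      simp only [h, h', if_true, if_false, decide_true, decide_false, scatter]
      generalize (p n).1 = x, (p n).2 = y, (p (n + 1)).1 = x', (p (n + 1)).2 = y' at *
      refine ⟨by linarith, by linarith, by simp, by linarith, ?_⟩
      rw [hx, hy, show x + a - 1 + 1 = x + a by ring, show x + a - 1 + -a = x - 1 by ring]
      ring
    · have h1 := zero n h
      have h2 := zero _ h'
      simp only [h, h', if_false, decide_false, scatter]
      generalize (p n).1 = x, (p n).2 = y, (p (n + 1)).1 = x', (p (n + 1)).2 = y' at *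
      have e : x' + -y = -y * (-a - 1) / (x - 1) := by
        rw [hx]
        field_simp
        ring
      have d1 : 0 < -y := by linarith
      have d2 : -a - 1 ≠ 0 := by linarith
      have d3 : y ≠ 0 := by linarith
      refine ⟨by linarith, d1, by simp, ?_, ?_⟩
      · rw [e]
        field_simp
        ring
      · rw [add_comm (-y), e, hx, hy]
        field_simp
        ring
  · by_cases h : (p n).1 ≤ 0 <;> simp [place, h]

theorem continuousAt_iterate_birat {a : ℝ} {q : ℝ × ℝ} {n : ℕ} (h : orbitDefined a q n) :
    ContinuousAt (birat a)^[n] q := by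
  induction n with
  | zero => exact continuousAt_id
  | succ n ih =>
    rw [Function.iterate_succ']
    refine ContinuousAt.comp ?_ (ih fun k hk => h k (by omega))
    have hne : ((birat a)^[n] q).1 - 1 ≠ 0 := sub_ne_zero.mpr (h n (by omega))
    unfold birat
    fun_prop (disch := assumption)

theorem iterate_birat_eq {a : ℝ} {p : ℤ → ℝ × ℝ} (h : ∀ n, p (n + 1) = birat a (p n))
    (n : ℤ) (k : ℕ) : (birat a)^[k] (p n) = p (n + k) := by
  induction k with
  | zero => simp
  | succ k ih =>
    rw [Function.iterate_succ_apply', ih, ← h]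
    congr 1
    push_cast
    ring

theorem orbitDefined_of_orbit {a : ℝ} {p : ℤ → ℝ × ℝ} (h : ∀ n, p (n + 1) = birat a (p n))
    (h1 : ∀ n, (p n).1 ≠ 1) (n : ℤ) (k : ℕ) : orbitDefined a (p n) k := fun i _ => by
  rw [iterate_birat_eq h]
  exact h1 _

theorem stmt16 (a : ℝ) (ha : a < -1) (p : ℤ → ℝ × ℝ)
    (horb : ∀ n : ℤ, (p n).1 ≠ 1 ∧ p (n + 1) = birat a (p n))
    (hR : ∀ n : ℤ, p n ∈ Rzero ∪ Rone) :
    ∀ ε > (0 : ℝ), ∃ (q : ℝ × ℝ) (m : ℕ), 1 ≤ m ∧ orbitDefined a q m ∧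
      (birat a)^[m] q = q ∧ eucDist q (p 0) < ε := by
  intro ε hε
  have hb : 1 < -a := by linarith
  obtain ⟨w, u, v, h, hp⟩ := exists_scatterOrbit ha horb hR
  obtain ⟨n, hn0, hn⟩ := h.exists_isDoubleZero_le hb 0
  obtain ⟨K, hK⟩ : ∃ K : ℕ, (K : ℤ) = -n := ⟨(-n).toNat, by omega⟩
  have hstep : ∀ n, p (n + 1) = birat a (p n) := fun n => (horb n).2
  have hbase : (fun z : ℝ × ℝ => (Real.exp z.1, -Real.exp z.2))
      (Real.log (u n), Real.log (v n)) = p n := by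
    rw [hp n, hn.1]
    simp [place, Real.exp_log (h n).1, Real.exp_log (h n).2.1]
  have hcont : ContinuousAt (fun z : ℝ × ℝ =>
      eucDist ((birat a)^[K] (Real.exp z.1, -Real.exp z.2)) (p 0))
      (Real.log (u n), Real.log (v n)) := by
    have c1 : Continuous fun q : ℝ × ℝ => eucDist q (p 0) := by
      unfold eucDist
      fun_prop
    have c2 : ContinuousAt (birat a)^[K] ((fun z : ℝ × ℝ => (Real.exp z.1, -Real.exp z.2))
        (Real.log (u n), Real.log (v n))) := by
      rw [hbase]
      exact continuousAt_iterate_birat (orbitDefined_of_orbit hstep (fun n => (horb n).1) n K)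
    have c3 : ContinuousAt (fun z : ℝ × ℝ => (Real.exp z.1, -Real.exp z.2))
      (Real.log (u n), Real.log (v n)) := by fun_prop
    exact c1.continuousAt.comp (ContinuousAt.comp c2 c3)
  have hval : eucDist ((birat a)^[K] ((fun z : ℝ × ℝ => (Real.exp z.1, -Real.exp z.2))
      (Real.log (u n), Real.log (v n)))) (p 0) = 0 := by
    rw [hbase, iterate_birat_eq hstep, hK]
    simp [eucDist]
  obtain ⟨η, hη, hclose⟩ := Metric.eventually_nhds_iff.mp
    (hcont.eventually_lt continuousAt_const (hval.trans_lt hε))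
  obtain ⟨k, l, hkn, hnl, hk, hl, hwin⟩ := h.exists_window hb hn hη
  obtain ⟨w', u', v', m, hm, h', hper, hww, hl'⟩ := exists_periodic_scatterOrbit hb
    (fun i => (h i).2.2.1) (hkn.trans hnl) hk hl.1
  obtain ⟨d1, d2⟩ := hwin w' u' v' h' hww hl'
  set q : ℤ → ℝ × ℝ := fun i => place (w' i) (u' i) (v' i) with hq
  have hqstep : ∀ i, q (i + 1) = birat a (q i) := fun i => (h'.birat_place ha i).2.symm
  refine ⟨q 0, m, hm, orbitDefined_of_orbit hqstep (fun i => (h'.birat_place ha i).1) 0 m, ?_, ?_⟩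
  · rw [iterate_birat_eq hqstep]
    simp only [hq, hper]
  · have hz := hclose (y := (Real.log (u' n), Real.log (v' n))) (by
      rw [dist_comm, Prod.dist_eq]
      exact max_lt d1 d2)
    have hqn : (Real.exp (Real.log (u' n)), -Real.exp (Real.log (v' n))) = q n := by
      rw [Real.exp_log (h' n).1, Real.exp_log (h' n).2.1]
      simp [hq, place, hww n hkn.le hnl.le, hn.1]
    simp only [hqn] at hz
    rw [iterate_birat_eq hqstep, hK] at hz
    simpa using hz
end

section
/- (Density of the parabolic basin.) The set B := {p ∈ ℝ² : there exists n ≥ 0 such that the forward orbit of p is defined up to time n and fⁿ(p) ∈ int R₊ = (-∞,1)×(-∞,0)} is dense in ℝ². -/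
open Filter

/-- Bernoulli's inequality in logarithmic form. -/
lemma mul_log_div_le_mul_log_sub_one_div {s t : ℝ} (hs : 1 < s) (hst : s < t) :
    t * (Real.log t - Real.log s) ≤ (t - 1) * (Real.log (t - 1) - Real.log (s - 1)) := by
  have ht : 0 < t - 1 := by linarith
  have ht0 : 0 < t := by linarith
  have hbern := one_add_mul_self_le_rpow_one_add (s := s / t - 1) (p := t / (t - 1))
    (by have : 0 < s / t := by positivity
        linarith)
    (by rw [le_div_iff₀ ht]; linarith)
  have hleft : 1 + t / (t - 1) * (s / t - 1) = (s - 1) / (t - 1) := by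
    field_simp
    ring
  rw [hleft, add_sub_cancel] at hbern
  have hlog := Real.log_le_log (div_pos (by linarith) ht) hbern
  rw [Real.log_rpow (by positivity), Real.log_div (by linarith) (by linarith),
    Real.log_div (by linarith) (by linarith)] at hlog
  have hmul := mul_le_mul_of_nonneg_left hlog ht.le
  have hcancel : (t - 1) * (t / (t - 1) * (Real.log s - Real.log t))
      = t * (Real.log s - Real.log t) := by
    field_simp
  linarith

/-- The shear `(A, E) ↦ (A, A E / (A + 1))` does not decrease the logarithmic height. -/
lemma log_sub_log_le_log_shear {A₁ A₂ E₁ E₂ : ℝ} (hA₁ : 0 < A₁) (hA : A₁ < A₂)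
    (hE₁ : 0 < E₁) (hE : E₁ < E₂) :
    A₁ * E₁ / (A₁ + 1) < A₂ * E₂ / (A₂ + 1) ∧
      Real.log E₂ - Real.log E₁ ≤
        Real.log (A₂ * E₂ / (A₂ + 1)) - Real.log (A₁ * E₁ / (A₁ + 1)) := by
  have hA₂ : 0 < A₂ := hA₁.trans hA
  have hE₂ : 0 < E₂ := hE₁.trans hE
  have hq : A₁ / (A₁ + 1) < A₂ / (A₂ + 1) := by
    rw [div_lt_div_iff₀ (by linarith) (by linarith)]
    linarith
  have hq₁ : 0 < A₁ / (A₁ + 1) := by positivity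
  have h₁ : A₁ * E₁ / (A₁ + 1) = A₁ / (A₁ + 1) * E₁ := by ring
  have h₂ : A₂ * E₂ / (A₂ + 1) = A₂ / (A₂ + 1) * E₂ := by ring
  rw [h₁, h₂, Real.log_mul hq₁.ne' hE₁.ne', Real.log_mul (hq₁.trans hq).ne' hE₂.ne']
  exact ⟨mul_lt_mul'' hq hE hq₁.le hE₁.le, by linarith [Real.log_lt_log hq₁ hq]⟩

/-- On the strip `1 < x < b`, the map expands the area of ordered rectangles. -/
lemma expansion_of_lt {b A₁ A₂ E₁ E₂ : ℝ} (hA₁ : 0 < A₁) (hA : A₁ < A₂)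
    (hE₁ : 1 < E₁) (hE : E₁ < E₂) (hx₁ : 1 < A₁ * (E₁ - 1)) (hx₂ : A₂ * (E₂ - 1) < b) :
    A₁ * (E₁ - 1) < A₂ * (E₂ - 1) ∧
    A₂ * E₂ / (A₂ * (E₂ - 1) - 1) < A₁ * E₁ / (A₁ * (E₁ - 1) - 1) ∧
    b / (b - 1) * ((A₂ - A₁) * (Real.log E₂ - Real.log E₁)) ≤
      (A₂ * (E₂ - 1) - A₁ * (E₁ - 1)) *
        (Real.log (A₁ * E₁ / (A₁ * (E₁ - 1) - 1)) -
          Real.log (A₂ * E₂ / (A₂ * (E₂ - 1) - 1))) := by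
  have hA₂ : 0 < A₂ := hA₁.trans hA
  have hx : A₁ * (E₁ - 1) < A₂ * (E₂ - 1) :=
    mul_lt_mul'' hA (by linarith) hA₁.le (by linarith)
  obtain ⟨he, hlog⟩ := log_sub_log_le_log_shear hA₁ hA (by linarith) hE
  set e₁ := A₁ * E₁ / (A₁ + 1) with he₁
  set e₂ := A₂ * E₂ / (A₂ + 1) with he₂
  have hx₁e : A₁ * (E₁ - 1) - 1 = (A₁ + 1) * (e₁ - 1) := by rw [he₁]; field_simp; ring
  have hx₂e : A₂ * (E₂ - 1) - 1 = (A₂ + 1) * (e₂ - 1) := by rw [he₂]; field_simp; ring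
  have hd₁ : A₁ * E₁ = (A₁ + 1) * e₁ := by rw [he₁]; field_simp
  have hd₂ : A₂ * E₂ = (A₂ + 1) * e₂ := by rw [he₂]; field_simp
  have h1e₁ : 0 < e₁ - 1 := by
    by_contra! h
    nlinarith
  have h1e₂ : 0 < e₂ - 1 := by linarith
  have hq₁ : A₁ * E₁ / (A₁ * (E₁ - 1) - 1) = e₁ / (e₁ - 1) := by
    rw [hd₁, hx₁e, mul_div_mul_left _ _ (by linarith)]
  have hq₂ : A₂ * E₂ / (A₂ * (E₂ - 1) - 1) = e₂ / (e₂ - 1) := by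
    rw [hd₂, hx₂e, mul_div_mul_left _ _ (by linarith)]
  refine ⟨hx, ?_, ?_⟩
  · rw [hq₁, hq₂, div_lt_div_iff₀ h1e₂ h1e₁]
    linarith
  rw [hq₁, hq₂, Real.log_div (by linarith) h1e₁.ne', Real.log_div (by linarith) h1e₂.ne']
  have hbern := mul_log_div_le_mul_log_sub_one_div (s := e₁) (t := e₂) (by linarith) he
  set l := Real.log e₂ - Real.log e₁ with hl
  have hl0 : 0 ≤ Real.log E₂ - Real.log E₁ := by
    linarith [Real.log_lt_log (by linarith : 0 < E₁) hE]
  have hb1 : 0 < b - 1 := by linarith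
  set x₁ := A₁ * (E₁ - 1) with hx₁d
  set x₂ := A₂ * (E₂ - 1) with hx₂d
  have hheight : l / (e₂ - 1) ≤ Real.log e₁ - Real.log (e₁ - 1) -
      (Real.log e₂ - Real.log (e₂ - 1)) := by
    rw [div_le_iff₀ h1e₂]
    linarith
  have hwidth : b / (b - 1) * (A₂ - A₁) * (e₂ - 1) ≤ x₂ - x₁ := by
    have h1 : (b / (b - 1)) * (x₂ - 1) ≤ x₂ - 1 + 1 := by
      rw [div_mul_eq_mul_div, div_le_iff₀ hb1]
      linarith
    have hcross : A₂ * x₁ ≤ A₁ * x₂ := by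
      have : 0 < A₁ * A₂ * (E₂ - E₁) := by
        have : 0 < E₂ - E₁ := by linarith
        positivity
      rw [hx₁d, hx₂d]
      linarith
    have h2 : x₂ * (A₂ - A₁) ≤ (x₂ - x₁) * (A₂ + 1) := by nlinarith
    have h3 : e₂ - 1 = (x₂ - 1) / (A₂ + 1) := by
      rw [hx₂e]; field_simp
    rw [h3, ← mul_div_assoc, div_le_iff₀ (by linarith)]
    nlinarith
  have hl1 : 0 ≤ l := hl0.trans hlog
  calc b / (b - 1) * ((A₂ - A₁) * (Real.log E₂ - Real.log E₁))
      ≤ b / (b - 1) * ((A₂ - A₁) * l) := by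
        have : 0 ≤ A₂ - A₁ := by linarith
        have : 0 ≤ b / (b - 1) := div_nonneg (by linarith) hb1.le
        gcongr
    _ = (b / (b - 1) * (A₂ - A₁) * (e₂ - 1)) * (l / (e₂ - 1)) := by
        field_simp
    _ ≤ _ := mul_le_mul hwidth hheight (by positivity) (by linarith)

/-- On the half-plane `b + 1 < x`, the second iterate does not decrease the area of ordered
rectangles. -/
lemma expansion_of_gt {b A₁ A₂ E₁ E₂ e₁ e₂ u₁ u₂ : ℝ} (hb : 1 < b) (hA₁ : 0 < A₁)
    (hA : A₁ < A₂) (hE₁ : 1 < E₁) (hE : E₁ < E₂) (hx₁ : b + 1 < A₁ * (E₁ - 1))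
    (he₁ : e₁ = A₁ * E₁ / (A₁ + 1)) (he₂ : e₂ = A₂ * E₂ / (A₂ + 1))
    (hu₁ : u₁ = A₁ + 1 - (b - 1) / (e₁ - 1)) (hu₂ : u₂ = A₂ + 1 - (b - 1) / (e₂ - 1)) :
    u₁ < u₂ ∧ e₁ * u₁ / (u₁ + 1) < e₂ * u₂ / (u₂ + 1) ∧
    (A₂ - A₁) * (Real.log E₂ - Real.log E₁) ≤
      (u₂ - u₁) * (Real.log (e₂ * u₂ / (u₂ + 1)) - Real.log (e₁ * u₁ / (u₁ + 1))) := by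
  obtain ⟨he, hlog⟩ := log_sub_log_le_log_shear hA₁ hA (by linarith) hE
  rw [← he₁, ← he₂] at he hlog
  have hx₁e : A₁ * (E₁ - 1) - 1 = (A₁ + 1) * (e₁ - 1) := by rw [he₁]; field_simp; ring
  have h1e₁ : 0 < e₁ - 1 := by
    by_contra! h
    nlinarith
  have h1e₂ : 0 < e₂ - 1 := by linarith
  have hu : A₂ - A₁ ≤ u₂ - u₁ := by
    have : (b - 1) / (e₂ - 1) ≤ (b - 1) / (e₁ - 1) :=
      div_le_div_of_nonneg_left (by linarith) h1e₁ (by linarith)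
    linarith
  have hu₁0 : 0 < u₁ := by
    rw [hu₁, sub_pos, div_lt_iff₀ h1e₁, ← hx₁e]
    linarith
  obtain ⟨h, hlog'⟩ := log_sub_log_le_log_shear hu₁0 (by linarith : u₁ < u₂)
    (by linarith : 0 < e₁) he
  rw [mul_comm e₁, mul_comm e₂]
  refine ⟨by linarith, h, mul_le_mul hu (hlog.trans hlog') ?_ (by linarith)⟩
  linarith [Real.log_lt_log (by linarith : 0 < E₁) hE]


/-- The points whose forward orbit is defined until it enters `intRplus`. -/
def basin (a : ℝ) : Set (ℝ × ℝ) :=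
  {p | ∃ n : ℕ, orbitDefined a p n ∧ (birat a)^[n] p ∈ intRplus}

lemma mem_basin_of_birat_mem {a : ℝ} {p : ℝ × ℝ} (hp : p.1 ≠ 1) (h : birat a p ∈ basin a) :
    p ∈ basin a := by
  obtain ⟨n, hdef, hmem⟩ := h
  refine ⟨n + 1, fun k hk => ?_, hmem⟩
  cases k with
  | zero => exact hp
  | succ k => exact hdef k (by omega)

/-- The interior of the complement of the basin. -/
def basinExterior (a : ℝ) : Set (ℝ × ℝ) := interior (basin a)ᶜ

lemma isOpen_basinExterior (a : ℝ) : IsOpen (basinExterior a) := isOpen_interior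

lemma notMem_intRplus {a : ℝ} {p : ℝ × ℝ} (hp : p ∈ basinExterior a) (h1 : p.1 < 1) :
    0 ≤ p.2 := by
  by_contra! h2
  exact interior_subset hp ⟨0, fun k hk => absurd hk (Nat.not_lt_zero k), h1, h2⟩

lemma birat_biratInv {a : ℝ} {q : ℝ × ℝ} (h2 : q.2 ≠ -1) (ha : q.2 ≠ a) :
    birat a (biratInv a q) = q := by
  have h2' : q.2 + 1 ≠ 0 := fun h => h2 (by linarith)
  have ha' : q.2 - a ≠ 0 := sub_ne_zero.2 ha
  have ha'' : q.2 + 1 - a - 1 ≠ 0 := by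
    convert ha' using 1
    ring
  ext
  · simp only [birat, biratInv]
    field_simp
    ring
  · simp only [birat, biratInv]
    ring

lemma biratInv_birat {a : ℝ} {p : ℝ × ℝ} (h1 : p.1 ≠ 1) (ha : p.1 ≠ -a) :
    biratInv a (birat a p) = p := by
  have h1' : p.1 - 1 ≠ 0 := sub_ne_zero.2 h1
  have ha' : p.1 + a ≠ 0 := fun h => ha (by linarith)
  ext
  · simp only [birat, biratInv]
    ring
  · simp only [birat, biratInv]
    have e₁ : p.1 + a - 1 - a = p.1 - 1 := by ring
    have e₂ : p.1 + a - 1 + 1 = p.1 + a := by ring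
    rw [e₁, e₂]
    field_simp

lemma birat_mem_basinExterior {a : ℝ} {p : ℝ × ℝ} (hp : p ∈ basinExterior a) (h1 : p.1 ≠ 1)
    (ha : p.1 ≠ -a) : birat a p ∈ basinExterior a := by
  have hsnd : (birat a p).2 = p.1 + a - 1 := rfl
  have h2 : (birat a p).2 ≠ -1 := fun h => ha (by linarith)
  have h2a : (birat a p).2 ≠ a := fun h => h1 (by linarith)
  have hcont : ContinuousAt (biratInv a) (birat a p) := by
    unfold biratInv
    have : (birat a p).2 + 1 ≠ 0 := fun h => h2 (by linarith)
    fun_prop (disch := assumption)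
  have hinv : ∀ᶠ q in nhds (birat a p), biratInv a q ∈ basinExterior a :=
    hcont.eventually_mem (by
      rw [biratInv_birat h1 ha]
      exact (isOpen_basinExterior a).mem_nhds hp)
  have hne : ∀ᶠ q in nhds (birat a p), q.2 ≠ -1 :=
    continuousAt_snd.eventually_ne h2
  have hne' : ∀ᶠ q in nhds (birat a p), q.2 ≠ a :=
    continuousAt_snd.eventually_ne h2a
  rw [basinExterior, mem_interior_iff_mem_nhds]
  filter_upwards [hinv, hne, hne'] with q hq hq2 hqa hqB
  refine interior_subset hq (mem_basin_of_birat_mem ?_ ?_)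
  · intro h
    apply hqa
    simp only [biratInv] at h
    linarith
  · rwa [birat_biratInv hq2 hqa]

lemma IsOpen.exists_shift_mem {U : Set (ℝ × ℝ)} (hU : IsOpen U) {p : ℝ × ℝ} (hp : p ∈ U)
    {δ : ℝ} (hδ : 0 < δ) :
    ∃ s, 0 < s ∧ s < δ ∧ ∀ x y, |x - p.1| ≤ s → |y - p.2| ≤ s → (x, y) ∈ U := by
  obtain ⟨ε, hε, hball⟩ := Metric.isOpen_iff.1 hU p hp
  refine ⟨min ε δ / 2, by positivity, ?_, fun x y hx hy => hball ?_⟩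
  · have := min_le_right ε δ
    linarith
  · have := min_le_left ε δ
    have : 0 < min ε δ := lt_min hε hδ
    rw [Metric.mem_ball, Prod.dist_eq, max_lt_iff, Real.dist_eq, Real.dist_eq]
    constructor <;> simp only <;> linarith

/-- The part of the basin exterior in the open region `intRzero`. -/
def trap (a : ℝ) : Set (ℝ × ℝ) := basinExterior a ∩ intRzero

lemma isOpen_trap (a : ℝ) : IsOpen (trap a) :=
  (isOpen_basinExterior a).inter
    ((isOpen_lt continuous_const continuous_fst).inter
      (isOpen_lt continuous_snd continuous_const))

lemma mem_trap_of_snd_lt {a : ℝ} {p : ℝ × ℝ} (hp : p ∈ basinExterior a) (h2 : p.2 < -1) :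
    p ∈ trap a := by
  refine ⟨hp, ?_, h2⟩
  by_contra! h
  obtain ⟨s, hs, -, hmem⟩ := (isOpen_basinExterior a).exists_shift_mem hp one_pos
  have := notMem_intRplus (hmem (p.1 - s) p.2 (by simp [abs_of_pos hs]) (by simp [hs.le]))
    (by simp only; linarith)
  simp only at this
  linarith

lemma fst_lt_or_lt_of_mem_trap {a : ℝ} (ha : a < -1) {p : ℝ × ℝ} (hp : p ∈ trap a) :
    p.1 < -a ∨ -a + 1 < p.1 := by
  by_contra! h
  obtain ⟨s, hs, hs2, hmem⟩ := (isOpen_trap a).exists_shift_mem hp (by norm_num : (0 : ℝ) < 1 / 2)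
  obtain ⟨x, hx1, hx2, hxs⟩ : ∃ x, -a < x ∧ x < -a + 1 ∧ |x - p.1| ≤ s := by
    rcases le_total p.1 (-a + 1 / 2) with hle | hle
    · exact ⟨p.1 + s, by linarith, by linarith, by simp [abs_of_pos hs]⟩
    · exact ⟨p.1 - s, by linarith, by linarith, by simp [abs_of_pos hs]⟩
  have hq := hmem x p.2 hxs (by simp [hs.le])
  have hp2 : p.2 < -1 := hp.2.2
  have hfq := birat_mem_basinExterior hq.1 (by simp only; linarith) (by simp only; linarith)
  have := notMem_intRplus hfq (by
    simp only [birat]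
    have : p.2 * (x + a) / (x - 1) < 0 :=
      div_neg_of_neg_of_pos (mul_neg_of_neg_of_pos (by linarith) (by linarith)) (by linarith)
    linarith)
  simp only [birat] at this
  linarith

lemma birat_mem_trap_of_lt {a : ℝ} {p : ℝ × ℝ} (hp : p ∈ trap a) (h : p.1 < -a) :
    birat a p ∈ trap a := by
  obtain ⟨hpe, h1, -⟩ := hp
  refine mem_trap_of_snd_lt (birat_mem_basinExterior hpe h1.ne' h.ne) ?_
  simp only [birat]
  linarith

lemma birat_mem_trap_of_mem_intRone {a : ℝ} (ha : a < -1) {p : ℝ × ℝ}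
    (hp : p ∈ basinExterior a) (h : p ∈ intRone) : birat a p ∈ trap a := by
  obtain ⟨h1, -⟩ := h
  refine mem_trap_of_snd_lt (birat_mem_basinExterior hp (by linarith) (by linarith)) ?_
  simp only [birat]
  linarith

lemma birat_birat_mem_trap_of_gt {a : ℝ} (ha : a < -1) {p : ℝ × ℝ} (hp : p ∈ trap a)
    (h : -a + 1 < p.1) : birat a (birat a p) ∈ trap a := by
  obtain ⟨hpe, h1, h2⟩ := hp
  refine birat_mem_trap_of_mem_intRone ha
    (birat_mem_basinExterior hpe h1.ne' (by linarith)) ⟨?_, ?_⟩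
  · exact div_neg_of_neg_of_pos (mul_neg_of_neg_of_pos (by linarith) (by linarith)) (by linarith)
  · simp only [birat]
    linarith

lemma trap_nonempty {a : ℝ} (ha : a < -1) (hne : (basinExterior a).Nonempty) :
    (trap a).Nonempty := by
  by_contra! hempty
  have hnot : ∀ p, p ∉ trap a := fun p hp => by simp [hempty] at hp
  have hpos : ∀ p ∈ basinExterior a, 0 ≤ p.1 := by
    intro p hp
    by_contra! h1
    have h2 := notMem_intRplus hp (by linarith)
    obtain ⟨s, hs, -, hmem⟩ := (isOpen_basinExterior a).exists_shift_mem hp one_pos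
    refine hnot _ (birat_mem_trap_of_mem_intRone ha
      (hmem p.1 (p.2 + s) (by simp [hs.le]) (by simp [abs_of_pos hs])) ⟨h1, ?_⟩)
    simp only
    linarith
  have hsnd : ∀ p ∈ basinExterior a, -1 ≤ p.2 := by
    intro p hp
    by_contra! h2
    exact hnot p (mem_trap_of_snd_lt hp h2)
  have hgt : ∀ p ∈ basinExterior a, -a < p.1 := by
    intro p hp
    by_contra! h1
    obtain ⟨s, hs, hs1, hmem⟩ := (isOpen_basinExterior a).exists_shift_mem hp one_pos
    obtain ⟨x, hx1, hxa, hxs⟩ : ∃ x, x ≠ 1 ∧ x < -a ∧ |x - p.1| ≤ s := by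
      by_cases hne : p.1 - s = 1
      · exact ⟨p.1 - s / 2, by linarith, by linarith, by
          rw [abs_le]; constructor <;> linarith⟩
      · exact ⟨p.1 - s, hne, by linarith, by simp [abs_of_pos hs]⟩
    have := hsnd _ (birat_mem_basinExterior (hmem x p.2 hxs (by simp [hs.le])) hx1 hxa.ne)
    simp only [birat] at this
    linarith
  have hmap : ∀ p ∈ basinExterior a, birat a p ∈ basinExterior a := by
    intro p hp
    have := hgt p hp
    exact birat_mem_basinExterior hp (by linarith) (by linarith)
  have hdecr : ∀ p ∈ basinExterior a, (birat a p).1 ≤ p.2 := by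
    intro p hp
    have h1 := hgt p hp
    have h2 := hgt _ (hmap p hp)
    simp only [birat] at h2 ⊢
    have hden : 0 < p.1 - 1 := by linarith
    rw [lt_div_iff₀ hden] at h2
    have hy : 0 < p.2 := by
      have : 0 < p.2 * (p.1 + a) := lt_trans (mul_pos (by linarith) hden) h2
      exact pos_of_mul_pos_left this (by linarith)
    rw [div_le_iff₀ hden]
    nlinarith
  have hiter : ∀ n : ℕ, ∃ p ∈ basinExterior a, p.1 ≤ hne.some.1 - n := by
    intro n
    induction n with
    | zero => exact ⟨_, hne.some_mem, by simp⟩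
    | succ n ih =>
      obtain ⟨p, hp, hpn⟩ := ih
      refine ⟨_, hmap _ (hmap p hp), (hdecr _ (hmap p hp)).trans ?_⟩
      simp only [birat]
      push_cast
      linarith
  obtain ⟨n, hn⟩ := exists_nat_gt hne.some.1
  obtain ⟨p, hp, hpn⟩ := hiter n
  have := hgt p hp
  linarith

/-- The coordinate `A = v - 1`, where `v = -y`. -/
def aCoord (p : ℝ × ℝ) : ℝ := -p.2 - 1

/-- The coordinate `E = (x + v - 1) / (v - 1)`, where `v = -y`. The invariant area form is
`dA ∧ d(log E)`. -/
noncomputable def eCoord (p : ℝ × ℝ) : ℝ := (p.1 - p.2 - 1) / (-p.2 - 1)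

lemma aCoord_pos {a : ℝ} {p : ℝ × ℝ} (hp : p ∈ trap a) : 0 < aCoord p := by
  have := hp.2.2
  unfold aCoord
  linarith

lemma one_lt_eCoord {a : ℝ} {p : ℝ × ℝ} (hp : p ∈ trap a) : 1 < eCoord p := by
  have h1 := hp.2.1
  have h2 := hp.2.2
  unfold eCoord
  rw [lt_div_iff₀ (by linarith)]
  linarith

lemma fst_eq_coord {a : ℝ} {p : ℝ × ℝ} (hp : p ∈ trap a) :
    aCoord p * (eCoord p - 1) = p.1 := by
  have h : -p.2 - 1 ≠ 0 := (aCoord_pos hp).ne'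
  unfold aCoord eCoord
  field_simp
  ring

/-- `p` and `q` are strictly ordered in the coordinates `(A, E)`, lie in a common preconnected
subset of `S`, and span a rectangle of invariant area at least `c`. -/
def SpansArea (S : Set (ℝ × ℝ)) (p q : ℝ × ℝ) (c : ℝ) : Prop :=
  aCoord p < aCoord q ∧ eCoord p < eCoord q ∧
    (∃ T ⊆ S, IsPreconnected T ∧ p ∈ T ∧ q ∈ T) ∧
    c ≤ (aCoord q - aCoord p) * (Real.log (eCoord q) - Real.log (eCoord p))

lemma SpansArea.left_mem {S : Set (ℝ × ℝ)} {p q : ℝ × ℝ} {c : ℝ} (h : SpansArea S p q c) :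
    p ∈ S := by
  obtain ⟨-, -, ⟨T, hTS, -, hp, -⟩, -⟩ := h
  exact hTS hp

lemma forall_fst_lt_of_isPreconnected {a : ℝ} (ha : a < -1) {T : Set (ℝ × ℝ)} (hT : T ⊆ trap a)
    (hconn : IsPreconnected T) {p : ℝ × ℝ} (hp : p ∈ T) (hlt : p.1 < -a) :
    ∀ q ∈ T, q.1 < -a := by
  intro q hq
  rcases fst_lt_or_lt_of_mem_trap ha (hT hq) with h | h
  · exact h
  obtain ⟨r, hr, hra⟩ := (hconn.image _ continuous_fst.continuousOn).ordConnected.out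
    (Set.mem_image_of_mem _ hp) (Set.mem_image_of_mem _ hq)
    (⟨hlt.le, by linarith⟩ : -a ∈ Set.Icc p.1 q.1)
  rcases fst_lt_or_lt_of_mem_trap ha (hT hr) with h' | h' <;> linarith

lemma continuousOn_birat {a : ℝ} {T : Set (ℝ × ℝ)} (hT : ∀ p ∈ T, p.1 ≠ 1) :
    ContinuousOn (birat a) T := by
  have : ∀ p ∈ T, p.1 - 1 ≠ 0 := fun p hp => sub_ne_zero.2 (hT p hp)
  unfold birat
  fun_prop (disch := assumption)

lemma SpansArea.birat_of_lt {a : ℝ} (ha : a < -1) {p q : ℝ × ℝ} {c : ℝ}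
    (h : SpansArea (trap a) p q c) (hlt : p.1 < -a) :
    SpansArea (trap a) (birat a q) (birat a p) (-a / (-a - 1) * c) ∧ c < -a := by
  obtain ⟨hA, hE, ⟨T, hT, hconn, hpT, hqT⟩, hc⟩ := h
  have hltT := forall_fst_lt_of_isPreconnected ha hT hconn hpT hlt
  have hp := hT hpT
  have hq := hT hqT
  have hq1 := hltT q hqT
  have hAp := aCoord_pos hp
  have hEp := one_lt_eCoord hp
  obtain ⟨hx, hE', harea⟩ := expansion_of_lt (b := -a) hAp hA hEp hE
    (by rw [fst_eq_coord hp]; exact hp.2.1) (by rw [fst_eq_coord hq]; exact hq1)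
  have hA_eq : ∀ r, aCoord (birat a r) = -a - r.1 := by
    intro r
    simp only [aCoord, birat]
    ring
  have hE_eq : ∀ r ∈ T, eCoord (birat a r) =
      aCoord r * eCoord r / (aCoord r * (eCoord r - 1) - 1) := by
    intro r hr
    have h1 : r.1 - 1 ≠ 0 := (sub_pos.2 (hT hr).2.1).ne'
    have h2 : -a - r.1 ≠ 0 := (sub_pos.2 (hltT r hr)).ne'
    have h3 : -r.2 - 1 ≠ 0 := (aCoord_pos (hT hr)).ne'
    rw [fst_eq_coord (hT hr)]
    have h4 : -(r.1 + a - 1) - 1 ≠ 0 := by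
      convert h2 using 1
      ring
    simp only [eCoord, birat, aCoord]
    field_simp
    ring
  refine ⟨⟨?_, ?_, ⟨birat a '' T, ?_, ?_, Set.mem_image_of_mem _ hqT,
    Set.mem_image_of_mem _ hpT⟩, ?_⟩, ?_⟩
  · rw [hA_eq, hA_eq, ← fst_eq_coord hp, ← fst_eq_coord hq]
    linarith
  · rwa [hE_eq q hqT, hE_eq p hpT]
  · rintro _ ⟨r, hr, rfl⟩
    exact birat_mem_trap_of_lt (hT hr) (hltT r hr)
  · exact hconn.image _ (continuousOn_birat fun r hr => (hT hr).2.1.ne')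
  · rw [hA_eq, hA_eq, hE_eq q hqT, hE_eq p hpT, ← fst_eq_coord hp, ← fst_eq_coord hq]
    refine (mul_le_mul_of_nonneg_left hc (div_nonneg (by linarith) (by linarith))).trans ?_
    linarith
  · have hlog : Real.log (eCoord q) - Real.log (eCoord p) ≤ eCoord q - 1 := by
      have := Real.log_le_sub_one_of_pos (by linarith : 0 < eCoord q)
      have := Real.log_pos hEp
      linarith
    have h0 : 0 ≤ Real.log (eCoord q) - Real.log (eCoord p) := by
      linarith [Real.log_lt_log (by linarith) hE]
    calc c ≤ _ := hc
      _ ≤ aCoord q * (eCoord q - 1) := mul_le_mul (by linarith) hlog h0 (by linarith)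
      _ = q.1 := fst_eq_coord hq
      _ < -a := hq1

lemma SpansArea.birat_birat_of_gt {a : ℝ} (ha : a < -1) {p q : ℝ × ℝ} {c : ℝ}
    (h : SpansArea (trap a) p q c) (hgt : -a + 1 < p.1) :
    SpansArea (trap a) (birat a (birat a p)) (birat a (birat a q)) c ∧
      aCoord (birat a (birat a p)) ≤ aCoord p + (-a + 1) ∧
      Real.log (eCoord (birat a (birat a p))) ≤ Real.log (eCoord p) - 1 / (aCoord p + 1) := by
  obtain ⟨hA, hE, ⟨T, hT, hconn, hpT, hqT⟩, hc⟩ := h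
  have hgtT : ∀ r ∈ T, -a + 1 < r.1 := by
    intro r hr
    rcases fst_lt_or_lt_of_mem_trap ha (hT hr) with h | h
    · have := forall_fst_lt_of_isPreconnected ha hT hconn hr h p hpT
      linarith
    · exact h
  have hp := hT hpT
  have hAp := aCoord_pos hp
  have hEp := one_lt_eCoord hp
  obtain ⟨e, he⟩ : ∃ e : ℝ × ℝ → ℝ, ∀ r, e r = aCoord r * eCoord r / (aCoord r + 1) :=
    ⟨_, fun _ => rfl⟩
  obtain ⟨u, hu⟩ : ∃ u : ℝ × ℝ → ℝ, ∀ r, u r = aCoord r + 1 - (-a - 1) / (e r - 1) :=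
    ⟨_, fun _ => rfl⟩
  have he_eq : ∀ r ∈ T, e r = (r.1 - r.2 - 1) / (-r.2) := by
    intro r hr
    have h3 : -r.2 - 1 ≠ 0 := (aCoord_pos (hT hr)).ne'
    rw [he]
    unfold aCoord eCoord
    rw [mul_div_cancel₀ _ h3]
    congr 1
    ring
  have hu_eq : ∀ r ∈ T, u r = -(birat a r).1 := by
    intro r hr
    have h1 : r.1 - 1 ≠ 0 := (sub_pos.2 (hT hr).2.1).ne'
    have h2 : r.2 ≠ 0 := by linarith [(hT hr).2.2]
    have h3 : e r - 1 = (r.1 - 1) / (-r.2) := by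
      rw [he_eq r hr]
      field_simp
      ring
    rw [hu, h3]
    simp only [birat, aCoord]
    field_simp
    ring
  have hu_pos : ∀ r ∈ T, 0 < u r := by
    intro r hr
    have h1 := hgtT r hr
    have h2 := (hT hr).2.2
    rw [hu_eq r hr, neg_pos]
    exact div_neg_of_neg_of_pos (mul_neg_of_neg_of_pos (by linarith) (by linarith)) (by linarith)
  have hA_eq : ∀ r ∈ T, aCoord (birat a (birat a r)) = u r - a := by
    intro r hr
    rw [hu_eq r hr]
    simp only [aCoord, birat]
    ring
  have hE_eq : ∀ r ∈ T, eCoord (birat a (birat a r)) = e r * u r / (u r + 1) := by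
    intro r hr
    have hu0 := hu_pos r hr
    have h1 : r.1 - 1 ≠ 0 := (sub_pos.2 (hT hr).2.1).ne'
    have h2 : r.2 ≠ 0 := by linarith [(hT hr).2.2]
    have heu : e r * u r = u r + r.1 + a := by
      rw [he_eq r hr, hu_eq r hr]
      simp only [birat]
      field_simp
      ring
    have hfst : (birat a r).1 = -u r := by rw [hu_eq r hr, neg_neg]
    have hsnd : (birat a r).2 = r.1 + a - 1 := rfl
    rw [heu]
    have h3 : u r + 1 ≠ 0 := by linarith
    have h4 : -u r - 1 ≠ 0 := by linarith
    have h5 : -(-u r + a - 1) - 1 ≠ 0 := by linarith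
    unfold eCoord
    rw [birat, hfst, hsnd]
    simp only
    field_simp
    ring
  obtain ⟨hu_lt, hE_lt, harea⟩ := expansion_of_gt (b := -a) (by linarith) hAp hA hEp hE
    (by rw [fst_eq_coord hp]; exact hgt) (he p) (he q) (hu p) (hu q)
  refine ⟨⟨?_, ?_, ⟨(fun r => birat a (birat a r)) '' T, ?_, ?_, Set.mem_image_of_mem _ hpT,
    Set.mem_image_of_mem _ hqT⟩, ?_⟩, ?_, ?_⟩
  · rw [hA_eq p hpT, hA_eq q hqT]
    linarith
  · rwa [hE_eq p hpT, hE_eq q hqT]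
  · rintro _ ⟨r, hr, rfl⟩
    exact birat_birat_mem_trap_of_gt ha (hT hr) (hgtT r hr)
  · refine hconn.image _ ?_
    refine ContinuousOn.comp (t := {r : ℝ × ℝ | r.1 ≠ 1}) (continuousOn_birat fun r hr => hr)
      (continuousOn_birat fun r hr => (hT hr).2.1.ne') fun r hr => ?_
    have := hu_pos r hr
    rw [hu_eq r hr] at this
    change (birat a r).1 ≠ 1
    linarith
  · rw [hA_eq p hpT, hA_eq q hqT, hE_eq p hpT, hE_eq q hqT]
    linarith
  · have h1e : 0 < e p - 1 := by
      have h1 := hp.2.1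
      have h2 := hp.2.2
      rw [he_eq p hpT, sub_pos, lt_div_iff₀ (by linarith)]
      linarith
    have : 0 ≤ (-a - 1) / (e p - 1) := div_nonneg (by linarith) h1e.le
    rw [hA_eq p hpT]
    linarith [hu p]
  · have hu0 := hu_pos p hpT
    have hq1 : 0 < aCoord p / (aCoord p + 1) := by positivity
    have hep : e p = aCoord p / (aCoord p + 1) * eCoord p := by rw [he]; ring
    have hep0 : 0 < e p := by rw [hep]; positivity
    have hle : eCoord (birat a (birat a p)) ≤ e p := by
      rw [hE_eq p hpT, div_le_iff₀ (by linarith)]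
      linarith
    have hpos : 0 < eCoord (birat a (birat a p)) := by
      rw [hE_eq p hpT]; positivity
    have hlog := Real.log_le_log hpos hle
    rw [hep, Real.log_mul hq1.ne' (by linarith)] at hlog
    have hlog' := Real.log_le_sub_one_of_pos hq1
    have : aCoord p / (aCoord p + 1) - 1 = -(1 / (aCoord p + 1)) := by
      field_simp
      ring
    linarith

/-- An orbit in the trap cannot stay forever in the half-plane `-a + 1 < x`. -/
lemma SpansArea.exists_fst_lt {a : ℝ} (ha : a < -1) {p q : ℝ × ℝ} {c : ℝ}
    (h : SpansArea (trap a) p q c) :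
    ∃ p' q', SpansArea (trap a) p' q' c ∧ p'.1 < -a := by
  by_contra! hno
  have hk : 0 < -a + 1 := by linarith
  set φ : ℝ × ℝ → ℝ := fun r => Real.log (aCoord r + 1) + (-a + 1) * Real.log (eCoord r) with hφ
  have hiter : ∀ n : ℕ, ∃ p' q', SpansArea (trap a) p' q' c ∧ φ p' ≤ φ p ∧
      Real.log (eCoord p') ≤ Real.log (eCoord p) - n / Real.exp (φ p) := by
    intro n
    induction n with
    | zero => exact ⟨p, q, h, le_rfl, by simp⟩
    | succ n ih =>
      obtain ⟨r, s, hrs, hφr, hEr⟩ := ih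
      have hr := hrs.left_mem
      have hgt : -a + 1 < r.1 :=
        (fst_lt_or_lt_of_mem_trap ha hr).resolve_left (not_lt.2 (hno r s hrs))
      obtain ⟨hnext, hA, hE⟩ := hrs.birat_birat_of_gt ha hgt
      have hAr := aCoord_pos hr
      have hA' := aCoord_pos hnext.left_mem
      refine ⟨_, _, hnext, le_trans ?_ hφr, ?_⟩
      · have hq : 0 < (aCoord r + 1 + (-a + 1)) / (aCoord r + 1) :=
          div_pos (by linarith) (by linarith)
        have hlog := Real.log_le_log (by linarith)
          (by linarith : aCoord (birat a (birat a r)) + 1 ≤ aCoord r + 1 + (-a + 1))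
        have hlog' := Real.log_le_sub_one_of_pos hq
        rw [Real.log_div (by linarith) (by linarith)] at hlog'
        have heq : (aCoord r + 1 + (-a + 1)) / (aCoord r + 1) - 1 =
            (-a + 1) * (1 / (aCoord r + 1)) := by
          field_simp
          ring
        have := mul_le_mul_of_nonneg_left hE hk.le
        simp only [hφ]
        linarith
      · have hbound : aCoord r + 1 ≤ Real.exp (φ p) := by
          rw [← Real.log_le_iff_le_exp (by linarith)]
          have := mul_pos hk (Real.log_pos (one_lt_eCoord hr))
          simp only [hφ] at hφr ⊢
          linarith
        have := one_div_le_one_div_of_le (by linarith) hbound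
        push_cast
        rw [add_div]
        linarith
  obtain ⟨n, hn⟩ := exists_nat_gt (Real.log (eCoord p) * Real.exp (φ p))
  obtain ⟨r, s, hrs, -, hE⟩ := hiter n
  have := Real.log_pos (one_lt_eCoord hrs.left_mem)
  rw [← lt_div_iff₀ (Real.exp_pos _)] at hn
  linarith

lemma exists_spansArea {a : ℝ} (h : (trap a).Nonempty) :
    ∃ p q c, 0 < c ∧ SpansArea (trap a) p q c := by
  obtain ⟨p, hp⟩ := h
  obtain ⟨ε, hε, hball⟩ := Metric.isOpen_iff.1 (isOpen_trap a) p hp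
  have hA := aCoord_pos hp
  have hx : 0 < p.1 := lt_trans one_pos hp.2.1
  set s := ε / 2 / (1 + 2 * p.1 + aCoord p) with hs
  have hden : 0 < 1 + 2 * p.1 + aCoord p := by linarith
  have hs0 : 0 < s := by positivity
  have hsε : s * (1 + 2 * p.1 + aCoord p) = ε / 2 := by rw [hs]; field_simp
  set q : ℝ × ℝ := (p.1 + 2 * p.1 * s, p.2 - aCoord p * s) with hq
  have hqball : q ∈ Metric.ball p ε := by
    rw [Metric.mem_ball, Prod.dist_eq, max_lt_iff, Real.dist_eq, Real.dist_eq, abs_lt, abs_lt]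
    have h1 : 0 < p.1 * s := by positivity
    have h2 : 0 < aCoord p * s := by positivity
    simp only [hq]
    refine ⟨⟨?_, ?_⟩, ?_, ?_⟩ <;> linarith
  have hqt := hball hqball
  have hAq : aCoord q = aCoord p * (1 + s) := by
    simp only [hq, aCoord]
    ring
  have hAlt : aCoord p < aCoord q := by
    rw [hAq]
    have : 0 < aCoord p * s := by positivity
    linarith
  have hElt : eCoord p < eCoord q := by
    have h1 : aCoord p * (eCoord p - 1) = p.1 := fst_eq_coord hp
    have h2 : aCoord q * (eCoord q - 1) = p.1 * (1 + 2 * s) := by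
      rw [fst_eq_coord hqt]
      simp only [hq]
      ring
    rw [hAq, ← h1, mul_assoc, mul_assoc, mul_right_inj' hA.ne'] at h2
    have := one_lt_eCoord hp
    have : 0 < (eCoord p - 1) * s := mul_pos (by linarith) hs0
    have : 0 < (eCoord q - eCoord p) * (1 + s) := by linarith
    linarith [pos_of_mul_pos_left this (by linarith)]
  refine ⟨p, q, _, ?_, hAlt, hElt, ⟨Metric.ball p ε, hball, (convex_ball p ε).isPreconnected,
    Metric.mem_ball_self hε, hqball⟩, le_rfl⟩
  have := one_lt_eCoord hp
  exact mul_pos (by linarith) (by linarith [Real.log_lt_log (by linarith) hElt])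

lemma not_spansArea {a : ℝ} (ha : a < -1) {p q : ℝ × ℝ} {c : ℝ} (hc : 0 < c) :
    ¬ SpansArea (trap a) p q c := by
  intro h
  have hiter : ∀ n : ℕ, ∃ p' q', SpansArea (trap a) p' q' ((-a / (-a - 1)) ^ n * c) := by
    intro n
    induction n with
    | zero => exact ⟨p, q, by simpa using h⟩
    | succ n ih =>
      obtain ⟨r, s, hrs⟩ := ih
      obtain ⟨r', s', hrs', hlt⟩ := hrs.exists_fst_lt ha
      refine ⟨birat a s', birat a r', ?_⟩
      rw [pow_succ', mul_assoc]
      exact (hrs'.birat_of_lt ha hlt).1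
  have hl : 1 < -a / (-a - 1) := by
    rw [lt_div_iff₀ (by linarith)]
    linarith
  obtain ⟨n, hn⟩ := pow_unbounded_of_one_lt (-a / c) hl
  obtain ⟨r, s, hrs⟩ := hiter n
  obtain ⟨r', s', hrs', hlt⟩ := hrs.exists_fst_lt ha
  have := (hrs'.birat_of_lt ha hlt).2
  rw [div_lt_iff₀ hc] at hn
  linarith

theorem stmt17 (a : ℝ) (ha : a < -1) :
    Dense {p : ℝ × ℝ | ∃ n : ℕ, orbitDefined a p n ∧ (birat a)^[n] p ∈ intRplus} := by
  change Dense (basin a)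
  rw [← interior_eq_empty_iff_dense_compl.trans (by rw [compl_compl] : _ ↔ Dense (basin a))]
  by_contra hne
  obtain ⟨p, q, c, hc, h⟩ :=
    exists_spansArea (trap_nonempty ha (Set.nonempty_iff_ne_empty.2 hne))
  exact not_spansArea ha hc h
end
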